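/- arXiv:1402.6405 — 8 statements merged into one kernel-verified Lean document; each statement's English description precedes it below -/
import Mathlib

section
/- Let F be an infinite field with char F ≠ 2 and let n ≥ 1. For any integer k ≥ 4 and any sequences a_1, …, a_k of positive integers (each with sum at most n), the set of G-orbits on the multiple flag variety M_{a_1} × ⋯ × M_{a_k} under the diagonal action of G = O_{2n+1}(F) is infinite. -/
open Module

/-- The symmetric bilinear form on `F^N` given by `(e_i, e_j) = δ_{i, N+1-j}`
(in 1-indexed notation), i.e. `(u, v) = ∑ i, u i * v (rev i)`. -/
def bform (F : Type*) [Field F] (N : ℕ) (u v : Fin N → F) : F :=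
  ∑ i, u i * v i.rev

/-- `g` belongs to the split orthogonal group `O_N(F)`. -/
def IsOrthMap (F : Type*) [Field F] (N : ℕ)
    (g : (Fin N → F) ≃ₗ[F] (Fin N → F)) : Prop :=
  ∀ u v, bform F N (g u) (g v) = bform F N u v

/-- A subspace `V` is isotropic if `(V, V) = {0}`. -/
def IsIsotropic (F : Type*) [Field F] (N : ℕ) (V : Submodule F (Fin N → F)) : Prop :=
  ∀ u ∈ V, ∀ v ∈ V, bform F N u v = 0

/-- A flag of type `a = (a 0, …, a (p-1))` in `F^{2n+1}` : an increasing chain of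
subspaces `V 0 ⊆ ⋯ ⊆ V (p-1)` with `dim (V i) = a 0 + ⋯ + a i` which is isotropic
(equivalently, by monotonicity, whose top member is isotropic). -/
def IsFlag (F : Type*) [Field F] (n p : ℕ) (a : Fin p → ℕ)
    (V : Fin p → Submodule F (Fin (2*n+1) → F)) : Prop :=
  Monotone V ∧ (∀ i : Fin p, finrank F (V i) = ∑ j ∈ Finset.Iic i, a j) ∧
    ∀ i : Fin p, IsIsotropic F (2*n+1) (V i)

/-- The flag variety `M_a`. -/
def FlagVar (F : Type*) [Field F] (n p : ℕ) (a : Fin p → ℕ) :=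
  { V : Fin p → Submodule F (Fin (2*n+1) → F) // IsFlag F n p a V }

/-- The orbit relation of the diagonal action of `O_{2n+1}(F)` on the triple flag
variety `M_a × M_b × M_c`. -/
def TripleRel (F : Type*) [Field F] (n p q r : ℕ)
    (a : Fin p → ℕ) (b : Fin q → ℕ) (c : Fin r → ℕ)
    (x y : FlagVar F n p a × FlagVar F n q b × FlagVar F n r c) : Prop :=
  ∃ g : (Fin (2*n+1) → F) ≃ₗ[F] (Fin (2*n+1) → F), IsOrthMap F (2*n+1) g ∧
    (∀ i, Submodule.map g.toLinearMap (x.1.1 i) = y.1.1 i) ∧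
    (∀ i, Submodule.map g.toLinearMap (x.2.1.1 i) = y.2.1.1 i) ∧
    (∀ i, Submodule.map g.toLinearMap (x.2.2.1 i) = y.2.2.1 i)

section BilinearForm

variable {F : Type*} [Field F] {N : ℕ}

lemma bform_add_left (u u' v : Fin N → F) :
    bform F N (u + u') v = bform F N u v + bform F N u' v := by
  simp [bform, add_mul, Finset.sum_add_distrib]

lemma bform_add_right (u v v' : Fin N → F) :
    bform F N u (v + v') = bform F N u v + bform F N u v' := by
  simp [bform, mul_add, Finset.sum_add_distrib]

lemma bform_smul_left (c : F) (u v : Fin N → F) :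
    bform F N (c • u) v = c * bform F N u v := by
  simp [bform, Finset.mul_sum, mul_assoc]

lemma bform_smul_right (c : F) (u v : Fin N → F) :
    bform F N u (c • v) = c * bform F N u v := by
  simp [bform, Finset.mul_sum, mul_left_comm]

lemma bform_comm (u v : Fin N → F) : bform F N u v = bform F N v u := by
  unfold bform
  rw [← Equiv.sum_comp Fin.revPerm]
  simp [mul_comm]

lemma bform_single_left (i : Fin N) (x : F) (v : Fin N → F) :
    bform F N (Pi.single i x) v = x * v i.rev := by
  unfold bform
  rw [Finset.sum_eq_single i] <;> simp +contextual

end BilinearForm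

section OrthMap

variable {F : Type*} [Field F] {N : ℕ}

lemma IsOrthMap.refl : IsOrthMap F N (LinearEquiv.refl F _) := fun _ _ => rfl

lemma IsOrthMap.symm {g : (Fin N → F) ≃ₗ[F] (Fin N → F)} (hg : IsOrthMap F N g) :
    IsOrthMap F N g.symm := fun u v => by
  rw [← hg, g.apply_symm_apply, g.apply_symm_apply]

lemma IsOrthMap.trans {g h : (Fin N → F) ≃ₗ[F] (Fin N → F)} (hg : IsOrthMap F N g)
    (hh : IsOrthMap F N h) : IsOrthMap F N (g.trans h) := fun u v => by
  rw [LinearEquiv.trans_apply, LinearEquiv.trans_apply, hh, hg]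

end OrthMap

section ConeSpace

variable (F : Type*) [Field F] (n : ℕ)

/-- The span of the first `m` standard basis vectors of `F^{2n+1}`. -/
def initialSpan (m : ℕ) : Submodule F (Fin (2*n+1) → F) :=
  Submodule.span F (Set.range fun i : Fin m => fun j => if (j : ℕ) = i then (1 : F) else 0)

variable {F n}

lemma apply_eq_zero_of_mem_initialSpan {m : ℕ} {z : Fin (2*n+1) → F}
    (hz : z ∈ initialSpan F n m) {j : Fin (2*n+1)} (hj : m ≤ j) : z j = 0 := by
  induction hz using Submodule.span_induction with
  | mem x hx =>
    obtain ⟨i, rfl⟩ := hx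
    have := i.2
    exact if_neg (by omega)
  | zero => rfl
  | add x y _ _ hx hy => simp [hx, hy]
  | smul c x _ hx => simp [hx]

lemma initialSpan_mono {m m' : ℕ} (h : m ≤ m') : initialSpan F n m ≤ initialSpan F n m' := by
  refine Submodule.span_mono ?_
  rintro _ ⟨i, rfl⟩
  exact ⟨Fin.castLE h i, rfl⟩

lemma linearIndependent_initial {m : ℕ} (hm : m ≤ 2*n+1) :
    LinearIndependent F
      (fun i : Fin m => fun j : Fin (2*n+1) => if (j : ℕ) = i then (1 : F) else 0) := by
  have h := (Pi.basisFun F (Fin (2*n+1))).linearIndependent.comp (Fin.castLE hm)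
    (Fin.castLE_injective hm)
  convert h using 1
  ext i j
  simp [Pi.single_apply, Fin.ext_iff]

/-- A vector of the three-dimensional nondegenerate middle part of `F^{2n+1}`. -/
def midVec (hn : 1 ≤ n) (x : Fin 3 → F) : Fin (2*n+1) → F :=
  Pi.single ⟨n-1, by omega⟩ (x 0) + Pi.single ⟨n, by omega⟩ (x 1)
    + Pi.single ⟨n+1, by omega⟩ (x 2)

lemma midVec_apply (hn : 1 ≤ n) (x : Fin 3 → F) (j : Fin (2*n+1)) :
    midVec hn x j = (if (j : ℕ) = n-1 then x 0 else 0) + (if (j : ℕ) = n then x 1 else 0)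
      + (if (j : ℕ) = n+1 then x 2 else 0) := by
  simp [midVec, Pi.single_apply, Fin.ext_iff]

lemma bform_midVec (hn : 1 ≤ n) (x y : Fin 3 → F) :
    bform F (2*n+1) (midVec hn x) (midVec hn y) = x 0 * y 2 + x 1 * y 1 + x 2 * y 0 := by
  have h₀ : midVec hn y (Fin.rev ⟨n-1, by omega⟩) = y 2 := by
    rw [midVec_apply, Fin.val_rev, if_neg (by simp; omega), if_neg (by simp; omega),
      if_pos (by simp; omega)]
    simp
  have h₁ : midVec hn y (Fin.rev ⟨n, by omega⟩) = y 1 := by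
    rw [midVec_apply, Fin.val_rev, if_neg (by simp; omega), if_pos (by simp; omega),
      if_neg (by simp; omega)]
    simp
  have h₂ : midVec hn y (Fin.rev ⟨n+1, by omega⟩) = y 0 := by
    rw [midVec_apply, Fin.val_rev, if_pos (by simp; omega), if_neg (by simp; omega),
      if_neg (by simp; omega)]
    simp
  conv_lhs => rw [midVec]
  rw [bform_add_left, bform_add_left, bform_single_left, bform_single_left, bform_single_left,
    h₀, h₁, h₂]

lemma midVec_eq_zero_of_mem_initialSpan (hn : 1 ≤ n) {m : ℕ} (hm : m < n) {x : Fin 3 → F}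
    (h : midVec hn x ∈ initialSpan F n m) : x = 0 := by
  have h₀ := apply_eq_zero_of_mem_initialSpan h (j := ⟨n-1, by omega⟩) (by simp; omega)
  have h₁ := apply_eq_zero_of_mem_initialSpan h (j := ⟨n, by omega⟩) (by simp; omega)
  have h₂ := apply_eq_zero_of_mem_initialSpan h (j := ⟨n+1, by omega⟩) (by simp; omega)
  rw [midVec_apply, if_pos rfl, if_neg (by dsimp only; omega), if_neg (by dsimp only; omega)] at h₀
  rw [midVec_apply, if_neg (by simp; omega), if_pos rfl, if_neg (by simp)] at h₁
  rw [midVec_apply, if_neg (by simp; omega), if_neg (by simp), if_pos rfl] at h₂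
  ext i
  fin_cases i <;> simp_all

/-- The span of a vector of the middle part together with the first `m` basis vectors. -/
def coneSpace (hn : 1 ≤ n) (x : Fin 3 → F) (m : ℕ) : Submodule F (Fin (2*n+1) → F) :=
  Submodule.span F {midVec hn x} ⊔ initialSpan F n m

lemma coneSpace_mono (hn : 1 ≤ n) (x : Fin 3 → F) : Monotone (coneSpace hn x) :=
  fun _ _ h => sup_le_sup_left (initialSpan_mono h) _

lemma midVec_mem_coneSpace (hn : 1 ≤ n) (x : Fin 3 → F) (m : ℕ) :
    midVec hn x ∈ coneSpace hn x m :=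
  Submodule.mem_sup_left (Submodule.mem_span_singleton_self _)

lemma mem_coneSpace {hn : 1 ≤ n} {x : Fin 3 → F} {m : ℕ} {u : Fin (2*n+1) → F} :
    u ∈ coneSpace hn x m ↔ ∃ c : F, ∃ z ∈ initialSpan F n m, c • midVec hn x + z = u := by
  simp [coneSpace, Submodule.mem_sup, Submodule.mem_span_singleton]

lemma finrank_coneSpace (hn : 1 ≤ n) {x : Fin 3 → F} (hx : x ≠ 0) {m : ℕ} (hm : m < n) :
    finrank F (coneSpace hn x m) = m + 1 := by
  have h : LinearIndependent F (Fin.cons (midVec hn x)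
      (fun i : Fin m => fun j : Fin (2*n+1) => if (j : ℕ) = i then (1 : F) else 0) :
        Fin (m+1) → Fin (2*n+1) → F) :=
    linearIndependent_finCons.2 ⟨linearIndependent_initial (by omega),
      fun h => hx (midVec_eq_zero_of_mem_initialSpan hn hm h)⟩
  have h' := finrank_span_eq_card h
  rwa [Fin.range_cons, Submodule.span_insert, Fintype.card_fin] at h'

lemma bform_initialSpan_eq_zero {m : ℕ} {z w : Fin (2*n+1) → F} (hm : m < n)
    (hz : z ∈ initialSpan F n m) (hw : ∀ j : Fin (2*n+1), n + 1 < (j : ℕ) → w j = 0) :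
    bform F (2*n+1) z w = 0 := by
  refine Finset.sum_eq_zero fun i _ => ?_
  rcases lt_or_ge (i : ℕ) m with hi | hi
  · rw [hw _ (by rw [Fin.val_rev]; omega), mul_zero]
  · rw [apply_eq_zero_of_mem_initialSpan hz hi, zero_mul]

lemma bform_cone (hn : 1 ≤ n) {x y : Fin 3 → F} {m m' : ℕ} (hm : m < n) (hm' : m' < n)
    {z w : Fin (2*n+1) → F} (hz : z ∈ initialSpan F n m) (hw : w ∈ initialSpan F n m')
    (c d : F) :
    bform F (2*n+1) (c • midVec hn x + z) (d • midVec hn y + w)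
      = c * d * (x 0 * y 2 + x 1 * y 1 + x 2 * y 0) := by
  have hmid : ∀ (x : Fin 3 → F) (j : Fin (2*n+1)), n + 1 < (j : ℕ) → midVec hn x j = 0 := by
    intro x j hj
    rw [midVec_apply, if_neg (by omega), if_neg (by omega), if_neg (by omega)]
    simp
  have h₁ := bform_initialSpan_eq_zero hm hz (hmid y)
  have h₂ := bform_initialSpan_eq_zero hm' hw (hmid x)
  have h₃ := bform_initialSpan_eq_zero (w := w) hm hz
    fun j hj => apply_eq_zero_of_mem_initialSpan hw (by omega)
  rw [bform_comm] at h₂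
  simp only [bform_add_left, bform_add_right, bform_smul_left, bform_smul_right, bform_midVec,
    h₁, h₂, h₃]
  ring

lemma isIsotropic_coneSpace (hn : 1 ≤ n) {x : Fin 3 → F} {m : ℕ} (hm : m < n)
    (hx : x 0 * x 2 + x 1 * x 1 + x 2 * x 0 = 0) :
    IsIsotropic F (2*n+1) (coneSpace hn x m) := by
  intro u hu v hv
  obtain ⟨c, z, hz, rfl⟩ := mem_coneSpace.1 hu
  obtain ⟨d, w, hw, rfl⟩ := mem_coneSpace.1 hv
  rw [bform_cone hn hm hm hz hw, hx, mul_zero]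

lemma isFlag_coneSpace (hn : 1 ≤ n) {x : Fin 3 → F} (hx₀ : x ≠ 0)
    (hx : x 0 * x 2 + x 1 * x 1 + x 2 * x 0 = 0) {p : ℕ} {a : Fin p → ℕ}
    (hpos : ∀ i, 0 < a i) (hsum : ∑ i, a i ≤ n) :
    IsFlag F n p a fun i => coneSpace hn x (∑ j ∈ Finset.Iic i, a j - 1) := by
  have hle : ∀ i, ∑ j ∈ Finset.Iic i, a j ≤ n := fun i =>
    (Finset.sum_le_sum_of_subset (Finset.subset_univ _)).trans hsum
  have hge : ∀ i, 0 < ∑ j ∈ Finset.Iic i, a j := fun i =>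
    Finset.sum_pos (fun j _ => hpos j) ⟨i, by simp⟩
  refine ⟨fun i i' h => coneSpace_mono hn x (Nat.sub_le_sub_right
    (Finset.sum_le_sum_of_subset (Finset.Iic_subset_Iic.2 h)) 1), fun i => ?_, fun i => ?_⟩
  · have := hle i
    have := hge i
    rw [finrank_coneSpace hn hx₀ (by omega)]
    omega
  · have := hle i
    exact isIsotropic_coneSpace hn (by omega) hx

/-- Isometries matching up cone spaces rescale the Gram matrix of their vertices. -/
lemma exists_gram_scaling (hn : 1 ≤ n) {ι : Type*} {x y : ι → Fin 3 → F} {m : ι → ℕ}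
    (hm : ∀ j, m j < n) {g : (Fin (2*n+1) → F) ≃ₗ[F] (Fin (2*n+1) → F)}
    (hg : IsOrthMap F (2*n+1) g)
    (h : ∀ j, (coneSpace hn (x j) (m j)).map g.toLinearMap = coneSpace hn (y j) (m j)) :
    ∃ c : ι → F, ∀ i j, x i 0 * x j 2 + x i 1 * x j 1 + x i 2 * x j 0
      = c i * c j * (y i 0 * y j 2 + y i 1 * y j 1 + y i 2 * y j 0) := by
  have hmem : ∀ j, g (midVec hn (x j)) ∈ coneSpace hn (y j) (m j) := fun j => by
    rw [← h j]
    exact Submodule.mem_map_of_mem (midVec_mem_coneSpace hn _ _)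
  choose c z hz hcz using fun j => mem_coneSpace.1 (hmem j)
  refine ⟨c, fun i j => ?_⟩
  rw [← bform_midVec hn, ← hg, ← hcz, ← hcz, bform_cone hn (hm i) (hm j) (hz i) (hz j)]

end ConeSpace

/-- Isotropic vectors in the three-dimensional quadratic space, the fourth depending on `t`. -/
def conicPoint {F : Type*} [Field F] (t : F) : ℕ → Fin 3 → F
  | 1 => ![1, 0, 0]
  | 2 => ![1, 1, -(1 / 2)]
  | 3 => ![1, t, -(t ^ 2 / 2)]
  | _ => ![0, 0, 1]

lemma conicPoint_ne_zero {F : Type*} [Field F] (t : F) (j : ℕ) : conicPoint t j ≠ 0 := by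
  intro h
  have h₀ := congrFun h 0
  have h₂ := congrFun h 2
  unfold conicPoint at h₀ h₂
  split at h₀ <;> simp_all

lemma conicPoint_isotropic {F : Type*} [Field F] (hchar : (2 : F) ≠ 0) (t : F) (j : ℕ) :
    conicPoint t j 0 * conicPoint t j 2 + conicPoint t j 1 * conicPoint t j 1
      + conicPoint t j 2 * conicPoint t j 0 = 0 := by
  unfold conicPoint
  split <;> simp <;> field_simp <;> ring

/-- If `k ≥ 4`, the multiple flag variety `M_{a_1} × ⋯ × M_{a_k}` has
infinitely many orbits under the diagonal action of `G = O_{2n+1}(F)`. -/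
theorem statement0 (F : Type*) [Field F] [Infinite F] (hchar : (2 : F) ≠ 0)
    (n : ℕ) (hn : 1 ≤ n) (k : ℕ) (hk : 4 ≤ k)
    (p : Fin k → ℕ) (hp : ∀ j, 1 ≤ p j)
    (a : (j : Fin k) → Fin (p j) → ℕ)
    (hpos : ∀ j i, 0 < a j i) (hsum : ∀ j, (∑ i, a j i) ≤ n) :
    Infinite (Quot (fun (x y :
        { V : (j : Fin k) → Fin (p j) → Submodule F (Fin (2*n+1) → F) //
          ∀ j, IsFlag F n (p j) (a j) (V j) }) =>
      ∃ g : (Fin (2*n+1) → F) ≃ₗ[F] (Fin (2*n+1) → F), IsOrthMap F (2*n+1) g ∧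
        ∀ j i, Submodule.map g.toLinearMap (x.1 j i) = y.1 j i)) := by
  set r := (fun (x y :
        { V : (j : Fin k) → Fin (p j) → Submodule F (Fin (2*n+1) → F) //
          ∀ j, IsFlag F n (p j) (a j) (V j) }) =>
      ∃ g : (Fin (2*n+1) → F) ≃ₗ[F] (Fin (2*n+1) → F), IsOrthMap F (2*n+1) g ∧
        ∀ j i, Submodule.map g.toLinearMap (x.1 j i) = y.1 j i)
  have hequiv : Equivalence r := by
    refine ⟨fun x => ⟨LinearEquiv.refl F _, IsOrthMap.refl, fun j i => Submodule.map_id _⟩, ?_, ?_⟩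
    · rintro x y ⟨g, hg, h⟩
      refine ⟨g.symm, hg.symm, fun j i => ?_⟩
      rw [← h j i, ← Submodule.map_comp]
      simp
    · rintro x y z ⟨g, hg, h⟩ ⟨g', hg', h'⟩
      refine ⟨g.trans g', hg.trans hg', fun j i => ?_⟩
      rw [← h' j i, ← h j i, ← Submodule.map_comp]
      rfl
  by_contra hfin
  rw [not_infinite_iff_finite] at hfin
  have : Infinite {t : F // t ≠ 0} := (Set.finite_singleton (0 : F)).infinite_compl.to_subtype
  let f : {t : F // t ≠ 0} → Quot r := fun t =>
    Quot.mk r ⟨fun j i => coneSpace hn (conicPoint t.1 j) (∑ l ∈ Finset.Iic i, a j l - 1),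
      fun j => isFlag_coneSpace hn (conicPoint_ne_zero _ _) (conicPoint_isotropic hchar _ _)
        (hpos j) (hsum j)⟩
  have hf : ∀ s t, f s = f t → s.1 ^ 2 = t.1 ^ 2 := by
    intro s t hst
    obtain ⟨g, hg, h⟩ := hequiv.eqvGen_iff.1 (Quot.eqvGen_exact hst)
    have hm : ∀ j : Fin k, ∑ l ∈ Finset.Iic (⟨0, hp j⟩ : Fin (p j)), a j l - 1 < n := fun j => by
      have := (Finset.sum_le_sum_of_subset (f := a j)
        (Finset.subset_univ (Finset.Iic ⟨0, hp j⟩))).trans (hsum j)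
      omega
    obtain ⟨c, hc⟩ := exists_gram_scaling hn hm hg fun j => h j ⟨0, hp j⟩
    have h₀₂ := hc ⟨0, by omega⟩ ⟨2, by omega⟩
    have h₀₃ := hc ⟨0, by omega⟩ ⟨3, by omega⟩
    have h₁₂ := hc ⟨1, by omega⟩ ⟨2, by omega⟩
    have h₁₃ := hc ⟨1, by omega⟩ ⟨3, by omega⟩
    generalize c ⟨0, _⟩ = c₀ at *
    generalize c ⟨1, _⟩ = c₁ at *
    generalize c ⟨2, _⟩ = c₂ at *
    generalize c ⟨3, _⟩ = c₃ at *
    simp [conicPoint] at h₀₂ h₀₃ h₁₂ h₁₃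
    field_simp at h₁₂ h₁₃
    have hone : c₁ * c₃ = 1 := by
      linear_combination c₁ * c₃ * h₀₂ - h₀₃ - c₀ * c₃ * h₁₂
    rw [h₁₃, hone, one_mul]
  obtain ⟨y, hy⟩ := Finite.exists_infinite_fiber f
  obtain ⟨s, hs⟩ := hy.nonempty
  refine Set.infinite_coe_iff.1 hy (Set.Finite.subset
    (Set.Finite.preimage Subtype.val_injective.injOn (Set.toFinite {s.1, -s.1})) ?_)
  intro t ht
  exact sq_eq_sq_iff_eq_or_eq_neg.1 (hf t s (ht.trans hs.symm))
end

section
/- Let F be an infinite field with char F ≠ 2 and let n ≥ 1. Let a, b, c be sequences of positive integers, each with sum at most n. If at least two of the three sequences a, b, c have length ≥ 2, then the set of G-orbits on the triple flag variety M_a × M_b × M_c under the diagonal action of G = O_{2n+1}(F) is infinite. -/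
open Module

/-- The five middle coordinates of a vector of `F^{2n+1}`, for `n ≥ 2`. -/
def middle (F : Type*) [Field F] (n : ℕ) (hn : 2 ≤ n) :
    (Fin (2*n+1) → F) →ₗ[F] (Fin 5 → F) where
  toFun v j := v ⟨n - 2 + j, by omega⟩
  map_add' _ _ := rfl
  map_smul' _ _ := rfl

/-- The inclusion of `F^5` into `F^{2n+1}` as the five middle coordinates. -/
def middleIncl (F : Type*) [Field F] (n : ℕ) :
    (Fin 5 → F) →ₗ[F] (Fin (2*n+1) → F) where
  toFun y i := if h : n ≤ (i : ℕ) + 2 ∧ (i : ℕ) < n + 3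
    then y ⟨i - (n - 2), by omega⟩ else 0
  map_add' x y := by
    funext i
    by_cases h : n ≤ (i : ℕ) + 2 ∧ (i : ℕ) < n + 3 <;> simp [h]
  map_smul' x y := by
    funext i
    by_cases h : n ≤ (i : ℕ) + 2 ∧ (i : ℕ) < n + 3 <;> simp [h]

/-- The subspace `A ⊕ ⟨e_1, …, e_k⟩` of `F^{2n+1}`, where `A` is a subspace of the span `F^5` of
the five middle basis vectors. -/
def inflate (F : Type*) [Field F] (n : ℕ) (hn : 2 ≤ n)
    (A : Submodule F (Fin 5 → F)) (k : ℕ) : Submodule F (Fin (2*n+1) → F) where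
  carrier := {v | middle F n hn v ∈ A ∧
    ∀ i : Fin (2*n+1), (k ≤ (i : ℕ) ∧ (i : ℕ) < n - 2) ∨ n + 3 ≤ (i : ℕ) → v i = 0}
  add_mem' {u v} hu hv := by
    refine ⟨by rw [map_add]; exact A.add_mem hu.1 hv.1, fun i hi => ?_⟩
    simp [hu.2 i hi, hv.2 i hi]
  zero_mem' := by
    refine ⟨by rw [map_zero]; exact A.zero_mem, fun i hi => rfl⟩
  smul_mem' c v hv := by
    refine ⟨by rw [map_smul]; exact A.smul_mem c hv.1, fun i hi => ?_⟩
    simp [hv.2 i hi]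

section

variable {F : Type*} [Field F] {n : ℕ} {hn : 2 ≤ n}

theorem middle_middleIncl (y : Fin 5 → F) : middle F n hn (middleIncl F n y) = y := by
  funext j
  have h : n ≤ n - 2 + (j : ℕ) + 2 ∧ n - 2 + (j : ℕ) < n + 3 := by omega
  simp [middle, middleIncl, h]

theorem middleIncl_mem_inflate {A : Submodule F (Fin 5 → F)} (k : ℕ) {y : Fin 5 → F}
    (hy : y ∈ A) : middleIncl F n y ∈ inflate F n hn A k := by
  refine ⟨by rwa [middle_middleIncl], fun i hi => ?_⟩
  have : ¬ (n ≤ (i : ℕ) + 2 ∧ (i : ℕ) < n + 3) := by omega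
  simp [middleIncl, this]

theorem bform_eq_bform_middle {u v : Fin (2*n+1) → F}
    (hu : ∀ i : Fin (2*n+1), n + 3 ≤ (i : ℕ) → u i = 0)
    (hv : ∀ i : Fin (2*n+1), n + 3 ≤ (i : ℕ) → v i = 0) :
    bform F (2*n+1) u v = bform F 5 (middle F n hn u) (middle F n hn v) := by
  unfold bform
  symm
  refine Finset.sum_of_injOn (fun j : Fin 5 => (⟨n - 2 + j, by omega⟩ : Fin (2*n+1)))
    ?_ (by simp) ?_ ?_
  · intro i _ j _ h
    simp only [Fin.mk.injEq] at h
    ext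
    omega
  · intro i _ hi
    by_cases h1 : n + 3 ≤ (i : ℕ)
    · rw [hu i h1, zero_mul]
    · rw [hv i.rev, mul_zero]
      rw [Fin.val_rev]
      by_contra h2
      refine hi ⟨⟨i - (n - 2), by omega⟩, by simp, ?_⟩
      ext
      simp only
      omega
  · intro j _
    have hj := j.2
    simp only [middle, LinearMap.coe_mk, AddHom.coe_mk]
    congr 2
    ext
    simp only [Fin.val_rev]
    omega

theorem finrank_inflate (A : Submodule F (Fin 5 → F)) {k : ℕ} (hk : k ≤ n - 2) :
    finrank F (inflate F n hn A k) = finrank F A + k := by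
  let e : inflate F n hn A k ≃ₗ[F] A × (Fin k → F) :=
    { toFun := fun v => (⟨middle F n hn v.1, v.2.1⟩, fun j => v.1 ⟨j, by omega⟩)
      map_add' := fun _ _ => rfl
      map_smul' := fun _ _ => rfl
      invFun := fun x => ⟨fun i => if h : (i : ℕ) < k then x.2 ⟨i, h⟩
          else middleIncl F n x.1.1 i, by
        have hx := middleIncl_mem_inflate (n := n) (hn := hn) k x.1.2
        refine ⟨?_, fun i hi => ?_⟩
        · convert hx.1 using 1
          funext j
          have : ¬ (n - 2 + (j : ℕ) < k) := by omega
          simp [middle, this]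
        · have : ¬ ((i : ℕ) < k) := by omega
          simpa [this] using hx.2 i hi⟩
      left_inv := by
        rintro ⟨v, hv⟩
        ext i
        by_cases h : (i : ℕ) < k
        · simp [h]
        · by_cases h2 : n ≤ (i : ℕ) + 2 ∧ (i : ℕ) < n + 3
          · simp [h, h2, middleIncl, middle]
          · have h3 := hv.2 i (by omega)
            simp [h, h2, middleIncl, h3]
      right_inv := by
        rintro ⟨y, z⟩
        refine Prod.ext (Subtype.ext ?_) ?_
        · refine Eq.trans ?_ (middle_middleIncl (n := n) (hn := hn) y.1)
          funext j
          have : ¬ (n - 2 + (j : ℕ) < k) := by omega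
          simp [middle, this]
        · funext j
          simp }
  rw [e.finrank_eq, finrank_prod, finrank_fin_fun]

theorem inflate_mono {A B : Submodule F (Fin 5 → F)} (hAB : A ≤ B) {k l : ℕ} (hkl : k ≤ l) :
    inflate F n hn A k ≤ inflate F n hn B l :=
  fun _ hv => ⟨hAB hv.1, fun i hi => hv.2 i (by omega)⟩

theorem isIsotropic_inflate {A : Submodule F (Fin 5 → F)} (hA : IsIsotropic F 5 A) (k : ℕ) :
    IsIsotropic F (2*n+1) (inflate F n hn A k) := by
  intro u hu v hv
  rw [bform_eq_bform_middle (hn := hn) (fun i hi => hu.2 i (Or.inr hi))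
    (fun i hi => hv.2 i (Or.inr hi))]
  exact hA _ hu.1 _ hv.1

theorem isFlag_inflate {p : ℕ} {a : Fin p → ℕ} {A : Fin p → Submodule F (Fin 5 → F)}
    {k : Fin p → ℕ} (hA : Monotone A) (hk : Monotone k) (hkn : ∀ i, k i ≤ n - 2)
    (hiso : ∀ i, IsIsotropic F 5 (A i))
    (hdim : ∀ i, finrank F (A i) + k i = ∑ j ∈ Finset.Iic i, a j) :
    IsFlag F n p a (fun i => inflate F n hn (A i) (k i)) :=
  ⟨fun _ _ hij => inflate_mono (hA hij) (hk hij),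
    fun i => by rw [finrank_inflate _ (hkn i), hdim],
    fun i => isIsotropic_inflate (hiso i) _⟩

theorem isIsotropic_span_singleton {N : ℕ} {x : Fin N → F} (h : bform F N x x = 0) :
    IsIsotropic F N (Submodule.span F {x}) := by
  intro u hu v hv
  obtain ⟨a, rfl⟩ := Submodule.mem_span_singleton.1 hu
  obtain ⟨b, rfl⟩ := Submodule.mem_span_singleton.1 hv
  have : bform F N (a • x) (b • x) = a * b * bform F N x x := by
    simp only [bform, Finset.mul_sum, Pi.smul_apply, smul_eq_mul]
    exact Finset.sum_congr rfl fun i _ => by ring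
  rw [this, h, mul_zero]

theorem isIsotropic_span_pair {N : ℕ} {x y : Fin N → F} (hx : bform F N x x = 0)
    (hxy : bform F N x y = 0) (hyx : bform F N y x = 0) (hy : bform F N y y = 0) :
    IsIsotropic F N (Submodule.span F {x, y}) := by
  intro u hu v hv
  obtain ⟨a, b, rfl⟩ := Submodule.mem_span_pair.1 hu
  obtain ⟨c, d, rfl⟩ := Submodule.mem_span_pair.1 hv
  have : bform F N (a • x + b • y) (c • x + d • y) = a * c * bform F N x x +
      a * d * bform F N x y + b * c * bform F N y x + b * d * bform F N y y := by
    simp only [bform, Finset.mul_sum, Pi.smul_apply, Pi.add_apply, smul_eq_mul,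
      ← Finset.sum_add_distrib]
    exact Finset.sum_congr rfl fun i _ => by ring
  rw [this, hx, hxy, hyx, hy]
  ring

theorem finrank_span_pair_eq_two {N : ℕ} {x y : Fin N → F}
    (h : ∀ s t : F, s • x + t • y = 0 → s = 0 ∧ t = 0) :
    finrank F (Submodule.span F {x, y}) = 2 := by
  have := finrank_span_eq_card (LinearIndependent.pair_iff.2 h)
  rwa [Matrix.range_cons_cons_empty, Fintype.card_fin] at this

/-- Two vectors spanning an isotropic line inside an isotropic plane of `F^5`. -/
structure IsotropicPair (x y : Fin 5 → F) : Prop where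
  left : bform F 5 x x = 0
  cross : bform F 5 x y = 0
  cross' : bform F 5 y x = 0
  right : bform F 5 y y = 0
  indep : ∀ s t : F, s • x + t • y = 0 → s = 0 ∧ t = 0

theorem IsotropicPair.finrank_span_singleton {x y : Fin 5 → F} (h : IsotropicPair x y) :
    finrank F (Submodule.span F {x}) = 1 := by
  refine _root_.finrank_span_singleton ?_
  rintro rfl
  simpa using (h.indep 1 0 (by simp)).1

/-- The line `⟨x⟩` or the plane `⟨x, y⟩`. -/
def lineOrPlane (x y : Fin 5 → F) (plane : Prop) [Decidable plane] : Submodule F (Fin 5 → F) :=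
  if plane then Submodule.span F {x, y} else Submodule.span F {x}

theorem IsotropicPair.isFlag {x y : Fin 5 → F} (h : IsotropicPair x y) {p : ℕ} {a : Fin p → ℕ}
    {plane : Fin p → Prop} [DecidablePred plane] (hmono : ∀ i j, i ≤ j → plane i → plane j)
    (hsum : ∀ i, (if plane i then 2 else 1) ≤ ∑ j ∈ Finset.Iic i, a j)
    (hk : Monotone fun i => (∑ j ∈ Finset.Iic i, a j) - if plane i then 2 else 1)
    (hle : ∀ i, (∑ j ∈ Finset.Iic i, a j) - (if plane i then 2 else 1) ≤ n - 2) :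
    IsFlag F n p a (fun i => inflate F n hn (lineOrPlane x y (plane i))
      ((∑ j ∈ Finset.Iic i, a j) - if plane i then 2 else 1)) := by
  refine isFlag_inflate ?_ hk hle ?_ ?_
  · intro i j hij
    unfold lineOrPlane
    beta_reduce
    split_ifs with h1 h2
    · exact le_rfl
    · exact absurd (hmono i j hij h1) h2
    · exact Submodule.span_mono (by simp)
    · exact le_rfl
  · intro i
    unfold lineOrPlane
    split_ifs
    · exact isIsotropic_span_pair h.left h.cross h.cross' h.right
    · exact isIsotropic_span_singleton h.left
  · intro i
    have := hsum i
    unfold lineOrPlane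
    split_ifs at this ⊢ with hi
    · rw [if_pos hi, finrank_span_pair_eq_two h.indep]
      omega
    · rw [if_neg hi, h.finrank_span_singleton]
      omega

theorem sum_Iic_le_sum {p : ℕ} (a : Fin p → ℕ) (i : Fin p) :
    ∑ j ∈ Finset.Iic i, a j ≤ ∑ j, a j :=
  Finset.sum_le_sum_of_subset (Finset.subset_univ _)

theorem sum_Iic_lt_sum_Iic {p : ℕ} {a : Fin p → ℕ} (ha : ∀ i, 0 < a i) {i j : Fin p}
    (h : i < j) : ∑ l ∈ Finset.Iic i, a l < ∑ l ∈ Finset.Iic j, a l :=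
  Finset.sum_lt_sum_of_subset (Finset.Iic_subset_Iic.2 h.le) (Finset.mem_Iic.2 le_rfl)
    (by simpa using h) (ha j) (by simp)

theorem sum_Iic_mono {p : ℕ} (a : Fin p → ℕ) {i j : Fin p} (h : i ≤ j) :
    ∑ l ∈ Finset.Iic i, a l ≤ ∑ l ∈ Finset.Iic j, a l :=
  Finset.sum_le_sum_of_subset (Finset.Iic_subset_Iic.2 h)

theorem sum_Iic_pos {p : ℕ} {a : Fin p → ℕ} (ha : ∀ i, 0 < a i) (i : Fin p) :
    0 < ∑ l ∈ Finset.Iic i, a l :=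
  Finset.sum_pos (fun _ _ => ha _) ⟨i, by simp⟩

/-- A flag whose first member is a line and whose later members contain a plane, up to a common
isotropic subspace. -/
theorem IsotropicPair.isFlag_pos {x y : Fin 5 → F} (h : IsotropicPair x y) {p : ℕ} {a : Fin p → ℕ}
    (ha : ∀ i, 0 < a i) (hsum : ∑ i, a i ≤ n) (hp : 2 ≤ p) :
    IsFlag F n p a (fun i => inflate F n hn (lineOrPlane x y (0 < (i : ℕ)))
      ((∑ j ∈ Finset.Iic i, a j) - if 0 < (i : ℕ) then 2 else 1)) := by
  have hlt : ∀ i j : Fin p, i < j → _ := fun i j hij => sum_Iic_lt_sum_Iic ha hij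
  refine h.isFlag (plane := fun i : Fin p => 0 < (i : ℕ)) ?_ ?_ ?_ ?_
  · intro i j hij
    rw [Fin.le_def] at hij
    omega
  · intro i
    have h0 := sum_Iic_pos ha ⟨0, by omega⟩
    have h1 := sum_Iic_pos ha i
    split_ifs with hi
    · have := hlt ⟨0, by omega⟩ i (by rwa [Fin.lt_def])
      omega
    · omega
  · intro i j hij
    rcases hij.eq_or_lt with rfl | hij'
    · exact le_rfl
    · have := hlt i j hij'
      have hj : 0 < (j : ℕ) := by rw [Fin.lt_def] at hij'; omega
      simp only [hj, if_true]
      split_ifs <;> omega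
  · intro i
    have h1 := sum_Iic_le_sum a i
    split_ifs with hi
    · omega
    · have := hlt i ⟨1, by omega⟩ (by rw [Fin.lt_def]; simp only; omega)
      have := sum_Iic_le_sum a ⟨1, by omega⟩
      omega

/-- A flag whose members contain a line, or a plane for the members of maximal dimension, up to a
common isotropic subspace. -/
theorem IsotropicPair.isFlag_top {x y : Fin 5 → F} (h : IsotropicPair x y) {p : ℕ} {a : Fin p → ℕ}
    (ha : ∀ i, 0 < a i) (hsum : ∑ i, a i ≤ n) :
    IsFlag F n p a (fun i => inflate F n hn (lineOrPlane x y (∑ j ∈ Finset.Iic i, a j = n))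
      ((∑ j ∈ Finset.Iic i, a j) - if ∑ j ∈ Finset.Iic i, a j = n then 2 else 1)) := by
  refine h.isFlag (plane := fun i => ∑ j ∈ Finset.Iic i, a j = n) ?_ ?_ ?_ ?_
  · intro i j hij
    have := sum_Iic_mono a hij
    have := sum_Iic_le_sum a j
    omega
  · intro i
    have := sum_Iic_pos ha i
    split_ifs <;> omega
  · intro i j hij
    have := sum_Iic_mono a hij
    have := sum_Iic_le_sum a j
    simp only
    split_ifs <;> omega
  · intro i
    have := sum_Iic_le_sum a i
    split_ifs <;> omega

/-- If `h` preserves the flags `⟨e_1⟩ ⊆ ⟨e_1, e_2⟩` and `⟨e_5⟩ ⊆ ⟨e_5, e_4⟩` and the pairings of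
their vectors with each other and with the vectors in `S`, then it acts diagonally on `S`, apart
from the middle coordinate. -/
theorem exists_diagonal {h : (Fin 5 → F) →ₗ[F] (Fin 5 → F)}
    {S : Set (Fin 5 → F)}
    (h0 : h ![1,0,0,0,0] ∈ Submodule.span F {![1,0,0,0,0]})
    (h1 : h ![0,1,0,0,0] ∈ Submodule.span F {![1,0,0,0,0], ![0,1,0,0,0]})
    (h4 : h ![0,0,0,0,1] ∈ Submodule.span F {![0,0,0,0,1]})
    (h3 : h ![0,0,0,1,0] ∈ Submodule.span F {![0,0,0,0,1], ![0,0,0,1,0]})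
    (hA : ∀ u ∈ ({![1,0,0,0,0], ![0,1,0,0,0]} : Set (Fin 5 → F)),
      ∀ v ∈ ({![0,0,0,0,1], ![0,0,0,1,0]} : Set (Fin 5 → F)),
      bform F 5 (h u) (h v) = bform F 5 u v)
    (hAS : ∀ u ∈ ({![1,0,0,0,0], ![0,1,0,0,0]} : Set (Fin 5 → F)),
      ∀ v ∈ S, bform F 5 (h u) (h v) = bform F 5 u v)
    (hBS : ∀ u ∈ ({![0,0,0,0,1], ![0,0,0,1,0]} : Set (Fin 5 → F)),
      ∀ v ∈ S, bform F 5 (h u) (h v) = bform F 5 u v) :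
    ∃ α γ : F, α ≠ 0 ∧ γ ≠ 0 ∧ ∀ v ∈ S, h v 0 = α * v 0 ∧ h v 1 = γ * v 1 ∧
      γ * h v 3 = v 3 ∧ α * h v 4 = v 4 := by
  obtain ⟨α, h0⟩ := Submodule.mem_span_singleton.1 h0
  obtain ⟨β, h4⟩ := Submodule.mem_span_singleton.1 h4
  obtain ⟨γ', γ, h1⟩ := Submodule.mem_span_pair.1 h1
  obtain ⟨δ', δ, h3⟩ := Submodule.mem_span_pair.1 h3
  have e04 := hA ![1,0,0,0,0] (by simp) ![0,0,0,0,1] (by simp)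
  have e03 := hA ![1,0,0,0,0] (by simp) ![0,0,0,1,0] (by simp)
  have e14 := hA ![0,1,0,0,0] (by simp) ![0,0,0,0,1] (by simp)
  have e13 := hA ![0,1,0,0,0] (by simp) ![0,0,0,1,0] (by simp)
  rw [← h0, ← h4] at e04
  rw [← h0, ← h3] at e03
  rw [← h1, ← h4] at e14
  rw [← h1, ← h3] at e13
  simp [bform, Fin.sum_univ_five, Fin.rev] at e04 e03 e14 e13
  have hα : α ≠ 0 := left_ne_zero_of_mul_eq_one e04
  have hβ : β ≠ 0 := right_ne_zero_of_mul_eq_one e04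
  have hδ' : δ' = 0 := e03.resolve_left hα
  have hγ' : γ' = 0 := e14.resolve_right hβ
  subst hδ' hγ'
  have hγδ : γ * δ = 1 := by linear_combination e13
  refine ⟨α, γ, hα, left_ne_zero_of_mul_eq_one hγδ, fun v hv => ?_⟩
  have f0 := hAS ![1,0,0,0,0] (by simp) v hv
  have f1 := hAS ![0,1,0,0,0] (by simp) v hv
  have f4 := hBS ![0,0,0,0,1] (by simp) v hv
  have f3 := hBS ![0,0,0,1,0] (by simp) v hv
  rw [← h0] at f0
  rw [← h1] at f1
  rw [← h4] at f4
  rw [← h3] at f3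
  simp [bform, Fin.sum_univ_five, Fin.rev] at f0 f1 f3 f4
  refine ⟨?_, ?_, f1, f0⟩
  · linear_combination α * f4 - h v 0 * e04
  · linear_combination γ * f3 - h v 1 * hγδ

/-- A vector of `F^5`, isotropic and depending on a parameter, with vanishing first coordinate. -/
def vecP (r : F) : Fin 5 → F := ![0, -2*r^2, 2*r, 1, 1]

/-- A vector of `F^5`, isotropic and depending on a parameter, with vanishing last coordinate. -/
def vecQ (r : F) : Fin 5 → F := ![-2*(1+r)^2, 2, 2, -1, 0]

theorem isotropicPair_left : IsotropicPair (![1,0,0,0,0] : Fin 5 → F) ![0,1,0,0,0] := by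
  constructor
  case indep =>
    intro s t hst
    have h0 := congrFun hst 0
    have h1 := congrFun hst 1
    simp at h0 h1
    exact ⟨h0, h1⟩
  all_goals simp [bform, Fin.sum_univ_five, Fin.rev]

theorem isotropicPair_right : IsotropicPair (![0,0,0,0,1] : Fin 5 → F) ![0,0,0,1,0] := by
  constructor
  case indep =>
    intro s t hst
    have h0 := congrFun hst 4
    have h1 := congrFun hst 3
    simp at h0 h1
    exact ⟨h0, h1⟩
  all_goals simp [bform, Fin.sum_univ_five, Fin.rev]

theorem isotropicPair_vecP_sub_vecQ (h2 : (2 : F) ≠ 0) (r : F) :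
    IsotropicPair (vecP r - vecQ r) (vecQ r) := by
  constructor
  case indep =>
    intro s t hst
    have h0 := congrFun hst 4
    have h1 := congrFun hst 2
    simp [vecP, vecQ] at h0 h1
    subst h0
    simpa [h2] using h1
  all_goals
    simp [bform, Fin.sum_univ_five, Fin.rev, vecP, vecQ]
    ring

/-- The diagonal action distinguishes the lines `⟨vecP r - vecQ r⟩`. -/
theorem eq_or_mul_eq_one_of_line (h2 : (2 : F) ≠ 0) {r s α γ l : F} {v : Fin 5 → F}
    (hv : l • (vecP s - vecQ s) = v)
    (h0 : v 0 = α * (vecP r - vecQ r) 0) (h1 : v 1 = γ * (vecP r - vecQ r) 1)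
    (h3 : γ * v 3 = (vecP r - vecQ r) 3) (h4 : α * v 4 = (vecP r - vecQ r) 4) :
    s = r ∨ r * s = 1 := by
  subst hv
  simp [vecP, vecQ] at h0 h1 h3 h4
  have hl : l ≠ 0 := right_ne_zero_of_mul_eq_one h4
  have hγ : γ * l = 1 := mul_right_cancel₀ h2 (by linear_combination h3)
  have hαγ : α = γ := mul_right_cancel₀ hl (by rw [h4, hγ])
  subst hαγ
  have k0 : l ^ 2 * (1 + s) ^ 2 = (1 + r) ^ 2 :=
    mul_left_cancel₀ h2 (by linear_combination l * h0 + 2 * (1 + r) ^ 2 * h4)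
  have k1 : l ^ 2 * (1 + s ^ 2) = 1 + r ^ 2 :=
    mul_left_cancel₀ h2 (by linear_combination -l * h1 + 2 * (1 + r ^ 2) * h4)
  have k : (s - r) * (r * s - 1) = 0 := by
    have : l ^ 2 * (2 * ((s - r) * (r * s - 1))) = 0 := by
      have h5 : l ^ 2 * (2 * ((s - r) * (r * s - 1))) =
        (1 + r) ^ 2 * (l ^ 2 * (1 + s ^ 2)) - (1 + r ^ 2) * (l ^ 2 * (1 + s) ^ 2) := by ring
      rw [h5, k0, k1]
      ring
    simpa [hl, h2] using this
  rcases mul_eq_zero.1 k with k | k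
  · exact Or.inl (sub_eq_zero.1 k)
  · exact Or.inr (sub_eq_zero.1 k)

/-- The diagonal action distinguishes the planes `⟨vecP r, vecQ r⟩`. -/
theorem eq_or_eq_of_plane (h2 : (2 : F) ≠ 0) {r s α γ : F} (hα : α ≠ 0) {v w : Fin 5 → F}
    (hv : v ∈ Submodule.span F {vecP s - vecQ s, vecQ s})
    (hw : w ∈ Submodule.span F {vecP s - vecQ s, vecQ s})
    (v0 : v 0 = α * vecP r 0) (v3 : γ * v 3 = vecP r 3) (v4 : α * v 4 = vecP r 4)
    (w0 : w 0 = α * vecQ r 0) (w1 : w 1 = γ * vecQ r 1) (w4 : α * w 4 = vecQ r 4) :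
    s = -1 ∨ s = r ∨ s = -2 - r := by
  by_cases hs : s = -1
  · exact Or.inl hs
  have hs' : 1 + s ≠ 0 := fun h => hs (by linear_combination h)
  obtain ⟨a, b, rfl⟩ := Submodule.mem_span_pair.1 hv
  obtain ⟨c, d, rfl⟩ := Submodule.mem_span_pair.1 hw
  simp [vecP, vecQ] at v0 v3 v4 w0 w1 w4
  have hc : c = 0 := w4.resolve_left hα
  subst hc
  have hab : a = b := by
    have : 2 * (1 + s) ^ 2 * (a - b) = 0 := by linear_combination v0
    simpa [h2, hs', sub_eq_zero] using this
  subst hab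
  have ha : a ≠ 0 := right_ne_zero_of_mul_eq_one v4
  have hαγ : α = γ := mul_right_cancel₀ ha (by linear_combination v4 - v3)
  subst hαγ
  have hd : d = α := mul_right_cancel₀ h2 (by linear_combination w1)
  subst hd
  have k : (s - r) * (s + 2 + r) = 0 := by
    have : d * 2 * ((s - r) * (s + 2 + r)) = 0 := by linear_combination -w0
    simpa [h2, hα] using this
  rcases mul_eq_zero.1 k with k | k
  · exact Or.inr (Or.inl (sub_eq_zero.1 k))
  · exact Or.inr (Or.inr (by linear_combination k))

/-- There is a family of triples of flags, only the third of which varies with the parameter, such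
that the parameters of the triples in any given orbit form a finite set. -/
theorem exists_flags (h2 : (2 : F) ≠ 0) {p q r : ℕ} (hr : 1 ≤ r)
    {a : Fin p → ℕ} {b : Fin q → ℕ} {c : Fin r → ℕ}
    (ha : ∀ i, 0 < a i) (hb : ∀ i, 0 < b i) (hc : ∀ i, 0 < c i)
    (hasum : (∑ i, a i) ≤ n) (hbsum : (∑ i, b i) ≤ n) (hcsum : (∑ i, c i) ≤ n)
    (hp : 2 ≤ p) (hq : 2 ≤ q) :
    ∃ (x : FlagVar F n p a) (y : FlagVar F n q b) (z : F → FlagVar F n r c),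
      ∀ t, {s | TripleRel F n p q r a b c (x, y, z t) (x, y, z s)}.Finite := by
  have hn : 2 ≤ n := by
    have h1 := sum_Iic_pos ha ⟨0, by omega⟩
    have h2 := sum_Iic_lt_sum_Iic ha
      (show (⟨0, by omega⟩ : Fin p) < ⟨1, by omega⟩ by rw [Fin.lt_def]; simp)
    have h3 := sum_Iic_le_sum a ⟨1, by omega⟩
    omega
  refine ⟨⟨_, (isotropicPair_left (F := F)).isFlag_pos (hn := hn) ha hasum hp⟩,
    ⟨_, (isotropicPair_right (F := F)).isFlag_pos (hn := hn) hb hbsum hq⟩,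
    fun t => ⟨_, (isotropicPair_vecP_sub_vecQ h2 t).isFlag_top (hn := hn) hc hcsum⟩, fun t => ?_⟩
  refine (Set.toFinite {t, t⁻¹, -1, -2 - t}).subset ?_
  rintro s ⟨g, hg, hx, hy, hz⟩
  have key : ∀ {A B : Submodule F (Fin 5 → F)} {k : ℕ},
      Submodule.map g.toLinearMap (inflate F n hn A k) = inflate F n hn B k →
      ∀ u ∈ A, middle F n hn (g (middleIncl F n u)) ∈ B ∧
        ∀ i : Fin (2*n+1), n + 3 ≤ (i : ℕ) → g (middleIncl F n u) i = 0 := by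
    intro A B k hAB u hu
    have hm : g (middleIncl F n u) ∈ inflate F n hn B k := by
      rw [← hAB]
      exact Submodule.mem_map_of_mem (middleIncl_mem_inflate k hu)
    exact ⟨hm.1, fun i hi => hm.2 i (Or.inr hi)⟩
  let h : (Fin 5 → F) →ₗ[F] (Fin 5 → F) :=
    middle F n hn ∘ₗ g.toLinearMap ∘ₗ middleIncl F n
  have pres : ∀ u v : Fin 5 → F,
      (∀ i : Fin (2*n+1), n + 3 ≤ (i : ℕ) → g (middleIncl F n u) i = 0) →
      (∀ i : Fin (2*n+1), n + 3 ≤ (i : ℕ) → g (middleIncl F n v) i = 0) →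
      bform F 5 (h u) (h v) = bform F 5 u v := by
    intro u v hu hv
    have hm : ∀ w : Fin 5 → F, ∀ i : Fin (2*n+1), n + 3 ≤ (i : ℕ) → middleIncl F n w i = 0 :=
      fun w i hi => (middleIncl_mem_inflate (hn := hn) 0 (Submodule.mem_top (x := w))).2 i
        (Or.inr hi)
    have := hg (middleIncl F n u) (middleIncl F n v)
    rwa [bform_eq_bform_middle (hn := hn) hu hv,
      bform_eq_bform_middle (hn := hn) (hm u) (hm v), middle_middleIncl, middle_middleIncl] at this
  have hx0 := key (hx ⟨0, by omega⟩)
  have hx1 := key (hx ⟨1, by omega⟩)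
  have hy0 := key (hy ⟨0, by omega⟩)
  have hy1 := key (hy ⟨1, by omega⟩)
  have hz0 := key (hz ⟨0, by omega⟩)
  simp only [lineOrPlane, lt_irrefl, if_false, zero_lt_one, if_true] at hx0 hx1 hy0 hy1 hz0
  obtain ⟨α, γ, hα, -, hdiag⟩ := exists_diagonal (h := h)
    (S := {v | ∀ i : Fin (2*n+1), n + 3 ≤ (i : ℕ) → g (middleIncl F n v) i = 0})
    (hx0 _ (Submodule.subset_span rfl)).1 (hx1 _ (Submodule.subset_span (by simp))).1
    (hy0 _ (Submodule.subset_span rfl)).1 (hy1 _ (Submodule.subset_span (by simp))).1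
    (fun u hu v hv => pres u v (hx1 _ (Submodule.subset_span hu)).2
      (hy1 _ (Submodule.subset_span hv)).2)
    (fun u hu v hv => pres u v (hx1 _ (Submodule.subset_span hu)).2 hv)
    (fun u hu v hv => pres u v (hy1 _ (Submodule.subset_span hu)).2 hv)
  split_ifs at hz0
  · have memQ : vecQ t ∈ Submodule.span F {vecP t - vecQ t, vecQ t} :=
      Submodule.subset_span (by simp)
    have memP : vecP t ∈ Submodule.span F {vecP t - vecQ t, vecQ t} := by
      have := Submodule.add_mem _ (Submodule.subset_span (R := F) (M := Fin 5 → F)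
        (s := {vecP t - vecQ t, vecQ t}) (by simp : vecP t - vecQ t ∈ _)) memQ
      rwa [sub_add_cancel] at this
    obtain ⟨v0, -, v3, v4⟩ := hdiag _ (hz0 _ memP).2
    obtain ⟨w0, w1, -, w4⟩ := hdiag _ (hz0 _ memQ).2
    rcases eq_or_eq_of_plane h2 hα (hz0 _ memP).1 (hz0 _ memQ).1 v0 v3 v4 w0 w1 w4 with
      e | e | e <;> simp [e]
  · have mem : vecP t - vecQ t ∈ Submodule.span F {vecP t - vecQ t} := Submodule.subset_span rfl
    obtain ⟨v0, v1, v3, v4⟩ := hdiag _ (hz0 _ mem).2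
    obtain ⟨l, hl⟩ := Submodule.mem_span_singleton.1 (hz0 _ mem).1
    rcases eq_or_mul_eq_one_of_line h2 hl v0 v1 v3 v4 with e | e
    · simp [e]
    · simp [eq_inv_of_mul_eq_one_right e]

end

theorem tripleRel_equivalence (F : Type*) [Field F] (n p q r : ℕ)
    (a : Fin p → ℕ) (b : Fin q → ℕ) (c : Fin r → ℕ) :
    Equivalence (TripleRel F n p q r a b c) where
  refl x := ⟨LinearEquiv.refl F _, fun _ _ => rfl, fun _ => Submodule.map_id _,
    fun _ => Submodule.map_id _, fun _ => Submodule.map_id _⟩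
  symm := by
    rintro x y ⟨g, hg, h1, h2, h3⟩
    have inv : ∀ {A B : Submodule F (Fin (2*n+1) → F)}, Submodule.map g.toLinearMap A = B →
        Submodule.map g.symm.toLinearMap B = A := by
      rintro A B rfl
      rw [← Submodule.map_comp, LinearEquiv.comp_coe, LinearEquiv.self_trans_symm]
      exact Submodule.map_id _
    refine ⟨g.symm, fun u v => ?_, fun i => inv (h1 i), fun i => inv (h2 i), fun i => inv (h3 i)⟩
    rw [← hg, g.apply_symm_apply, g.apply_symm_apply]
  trans := by
    rintro x y z ⟨g, hg, h1, h2, h3⟩ ⟨g', hg', h1', h2', h3'⟩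
    refine ⟨g.trans g', fun u v => ?_, fun i => ?_, fun i => ?_, fun i => ?_⟩
    · rw [LinearEquiv.trans_apply, LinearEquiv.trans_apply, hg', hg]
    · rw [← h1', ← h1, ← Submodule.map_comp, LinearEquiv.comp_coe]
    · rw [← h2', ← h2, ← Submodule.map_comp, LinearEquiv.comp_coe]
    · rw [← h3', ← h3, ← Submodule.map_comp, LinearEquiv.comp_coe]

theorem Equivalence.infinite_quot {α ι : Type*} [Infinite ι] {R : α → α → Prop}
    (hR : Equivalence R) (f : ι → α) (hf : ∀ t, {s | R (f t) (f s)}.Finite) :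
    Infinite (Quot R) := by
  by_contra hfin
  rw [not_infinite_iff_finite] at hfin
  obtain ⟨y, hy⟩ := Finite.exists_infinite_fiber fun t => Quot.mk R (f t)
  rw [Set.infinite_coe_iff] at hy
  obtain ⟨t, ht⟩ := hy.nonempty
  refine hy ((hf t).subset fun s hs => ?_)
  exact hR.eqvGen_iff.1 (Quot.eqvGen_exact (Eq.trans ht (Eq.symm hs)))

/-- if at least two of the three sequences `a, b, c` have length `≥ 2`,
the triple flag variety `M_a × M_b × M_c` has infinitely many `O_{2n+1}(F)`-orbits. -/
theorem statement1 (F : Type*) [Field F] [Infinite F] (hchar : (2 : F) ≠ 0)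
    (n : ℕ) (hn : 1 ≤ n) (p q r : ℕ) (hp : 1 ≤ p) (hq : 1 ≤ q) (hr : 1 ≤ r)
    (a : Fin p → ℕ) (b : Fin q → ℕ) (c : Fin r → ℕ)
    (hapos : ∀ i, 0 < a i) (hbpos : ∀ i, 0 < b i) (hcpos : ∀ i, 0 < c i)
    (hasum : (∑ i, a i) ≤ n) (hbsum : (∑ i, b i) ≤ n) (hcsum : (∑ i, c i) ≤ n)
    (hlen : (2 ≤ p ∧ 2 ≤ q) ∨ (2 ≤ p ∧ 2 ≤ r) ∨ (2 ≤ q ∧ 2 ≤ r)) :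
    Infinite (Quot (TripleRel F n p q r a b c)) := by
  rcases hlen with ⟨h1, h2⟩ | ⟨h1, h2⟩ | ⟨h1, h2⟩
  · obtain ⟨x, y, z, h⟩ := exists_flags hchar hr hapos hbpos hcpos hasum hbsum hcsum h1 h2
    exact (tripleRel_equivalence F n p q r a b c).infinite_quot (fun t => (x, y, z t)) h
  · obtain ⟨x, y, z, h⟩ := exists_flags hchar hq hapos hcpos hbpos hasum hcsum hbsum h1 h2
    refine (tripleRel_equivalence F n p q r a b c).infinite_quot (fun t => (x, z t, y))
      fun t => (h t).subset ?_
    rintro s ⟨g, hg, hx, hz, hy⟩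
    exact ⟨g, hg, hx, hy, hz⟩
  · obtain ⟨x, y, z, h⟩ := exists_flags hchar hp hbpos hcpos hapos hbsum hcsum hasum h1 h2
    refine (tripleRel_equivalence F n p q r a b c).infinite_quot (fun t => (z t, x, y))
      fun t => (h t).subset ?_
    rintro s ⟨g, hg, hz, hx, hy⟩
    exact ⟨g, hg, hx, hy, hz⟩
end

section
/- Let F be a field with char F ≠ 2, n ≥ 1, and let W be a subspace of F^{2n+1} on which the bilinear form is nondegenerate. Let W_1, …, W_k, W'_1, …, W'_k be subspaces of W with W = W_1 + ⋯ + W_k = W'_1 + ⋯ + W'_k. Let U_1 be an isotropic subspace of the orthogonal complement W^⊥ and let U_2, …, U_k be subspaces of U_1. If g ∈ G = O_{2n+1}(F) satisfies g(W_i + U_i) = W'_i + U_i for i = 1, …, k, then g(W + U_1) = W + U_1 and gU_1 = U_1. -/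
open Module

/-- The orthogonal space `S^⊥ = {v : (v, S) = {0}}` of a subspace `S`. -/
def orthCompl (F : Type*) [Field F] (N : ℕ) (S : Submodule F (Fin N → F)) :
    Submodule F (Fin N → F) where
  carrier := {v | ∀ s ∈ S, bform F N v s = 0}
  zero_mem' := by
    intro s hs
    simp [bform]
  add_mem' := by
    intro a b ha hb s hs
    have h1 := ha s hs
    have h2 := hb s hs
    simp only [bform, Pi.add_apply, add_mul, Finset.sum_add_distrib] at h1 h2 ⊢
    rw [h1, h2, add_zero]
  smul_mem' := by
    intro t v hv s hs
    have h1 := hv s hs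
    simp only [bform, Pi.smul_apply, smul_eq_mul, mul_assoc, ← Finset.mul_sum] at h1 ⊢
    rw [h1, mul_zero]

theorem bform_add_left_s5 {F : Type*} [Field F] {N : ℕ} (a b c : Fin N → F) :
    bform F N (a + b) c = bform F N a c + bform F N b c := by
  simp [bform, add_mul, Finset.sum_add_distrib]

theorem bform_add_right_s5 {F : Type*} [Field F] {N : ℕ} (a b c : Fin N → F) :
    bform F N a (b + c) = bform F N a b + bform F N a c := by
  simp [bform, mul_add, Finset.sum_add_distrib]

/-- If the form is nondegenerate on `W`, an isotropic `V ≤ W^⊥` is the radical of `W ⊔ V`. -/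
theorem mem_iff_mem_radical_sup {F : Type*} [Field F] {N : ℕ}
    {W V : Submodule F (Fin N → F)}
    (hW : ∀ w ∈ W, (∀ w' ∈ W, bform F N w w' = 0) → w = 0)
    (hV : V ≤ orthCompl F N W) (hViso : IsIsotropic F N V) (x : Fin N → F) :
    x ∈ V ↔ x ∈ W ⊔ V ∧ ∀ y ∈ W ⊔ V, bform F N x y = 0 := by
  constructor
  · intro hx
    refine ⟨Submodule.mem_sup_right hx, fun y hy => ?_⟩
    obtain ⟨w, hw, v, hv, rfl⟩ := Submodule.mem_sup.1 hy
    rw [bform_add_right_s5, hV hx w hw, hViso x hx v hv, add_zero]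
  · rintro ⟨hx, hrad⟩
    obtain ⟨w, hw, v, hv, rfl⟩ := Submodule.mem_sup.1 hx
    have hw0 : w = 0 := hW w hw fun w' hw' => by
      have h := hrad w' (Submodule.mem_sup_left hw')
      rwa [bform_add_left_s5, hV hv w' hw', add_zero] at h
    rwa [hw0, zero_add]

/-- Lemma 2.1': if `W` is nondegenerate, `W = W_1 + ⋯ + W_k
= W'_1 + ⋯ + W'_k`, `U_1 ⊆ W^⊥` is isotropic, `U_2, …, U_k ⊆ U_1`, and
`g ∈ O_{2n+1}(F)` satisfies `g(W_i + U_i) = W'_i + U_i` for all `i`, then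
`g(W + U_1) = W + U_1` and `g U_1 = U_1`. -/
theorem statement5 (F : Type*) [Field F] (hchar : (2 : F) ≠ 0)
    (n : ℕ) (hn : 1 ≤ n)
    (W : Submodule F (Fin (2*n+1) → F))
    (hWnd : ∀ w ∈ W, (∀ w' ∈ W, bform F (2*n+1) w w' = 0) → w = 0)
    (k : ℕ) (hk : 0 < k)
    (Ws Ws' U : Fin k → Submodule F (Fin (2*n+1) → F))
    (hWs : (⨆ i, Ws i) = W) (hWs' : (⨆ i, Ws' i) = W)
    (hWsub : ∀ i, Ws i ≤ W) (hWsub' : ∀ i, Ws' i ≤ W)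
    (hU1 : U ⟨0, hk⟩ ≤ orthCompl F (2*n+1) W)
    (hU1iso : IsIsotropic F (2*n+1) (U ⟨0, hk⟩))
    (hUsub : ∀ i, U i ≤ U ⟨0, hk⟩)
    (g : (Fin (2*n+1) → F) ≃ₗ[F] (Fin (2*n+1) → F)) (hg : IsOrthMap F (2*n+1) g)
    (hgi : ∀ i, Submodule.map g.toLinearMap (Ws i ⊔ U i) = Ws' i ⊔ U i) :
    Submodule.map g.toLinearMap (W ⊔ U ⟨0, hk⟩) = W ⊔ U ⟨0, hk⟩ ∧
      Submodule.map g.toLinearMap (U ⟨0, hk⟩) = U ⟨0, hk⟩ := by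
  have hUsup : (⨆ i, U i) = U ⟨0, hk⟩ := le_antisymm (iSup_le hUsub) (le_iSup U _)
  have hmap : Submodule.map g.toLinearMap (W ⊔ U ⟨0, hk⟩) = W ⊔ U ⟨0, hk⟩ := by
    calc Submodule.map g.toLinearMap (W ⊔ U ⟨0, hk⟩)
        = Submodule.map g.toLinearMap (⨆ i, Ws i ⊔ U i) := by rw [iSup_sup_eq, hWs, hUsup]
      _ = ⨆ i, Ws' i ⊔ U i := by simp only [Submodule.map_iSup, hgi]
      _ = W ⊔ U ⟨0, hk⟩ := by rw [iSup_sup_eq, hWs', hUsup]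
  have hrad := mem_iff_mem_radical_sup hWnd hU1 hU1iso
  refine ⟨hmap, le_antisymm ?_ fun x hx => ?_⟩
  · rintro _ ⟨x, hx, rfl⟩
    obtain ⟨hxM, hx0⟩ := (hrad x).1 hx
    refine (hrad _).2 ⟨hmap.le (Submodule.mem_map_of_mem hxM), fun y hy => ?_⟩
    obtain ⟨y, hyM, rfl⟩ := hmap.ge hy
    exact (hg x y).trans (hx0 y hyM)
  · obtain ⟨hxM, hx0⟩ := (hrad x).1 hx
    obtain ⟨x, hxM', rfl⟩ := hmap.ge hxM
    refine Submodule.mem_map_of_mem ((hrad x).2 ⟨hxM', fun y hy => ?_⟩)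
    exact (hg x y).symm.trans (hx0 _ (hmap.le (Submodule.mem_map_of_mem hy)))
end

section
/- Let F be a field with char F ≠ 2. Equip F^3 with the symmetric bilinear form (e_i, e_j) = δ_{i, 4-j} on the standard basis e_1, e_2, e_3, and let W_1 = F·(e_1 + e_2 − (1/2)e_3). If g ∈ O_3(F) satisfies g(F·e_1) = F·e_1, g(F·e_3) = F·e_3 and gW_1 = W_1, then g = id or g = −id. -/
open Module

/-- A linear map sending the line through `x` to itself has `x` as an eigenvector. -/
theorem exists_smul_eq_of_map_span_singleton_eq {F V : Type*} [Field F] [AddCommGroup V]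
    [Module F V] {f : V →ₗ[F] V} {x : V}
    (h : Submodule.map f (Submodule.span F {x}) = Submodule.span F {x}) :
    ∃ a : F, f x = a • x := by
  have hx : f x ∈ Submodule.span F {x} :=
    h ▸ Submodule.mem_map_of_mem (Submodule.mem_span_singleton_self x)
  obtain ⟨a, ha⟩ := Submodule.mem_span_singleton.mp hx
  exact ⟨a, ha.symm⟩

/-- Eigenvectors of an orthogonal map that are not orthogonal to each other have mutually
inverse eigenvalues. -/
theorem IsOrthMap.mul_eq_one {F : Type*} [Field F] {N : ℕ}
    {g : (Fin N → F) ≃ₗ[F] (Fin N → F)} (hg : IsOrthMap F N g) {u v : Fin N → F} {a b : F}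
    (hu : g u = a • u) (hv : g v = b • v) (huv : bform F N u v ≠ 0) : a * b = 1 := by
  have h := hg u v
  have hsmul : bform F N (a • u) (b • v) = a * b * bform F N u v := by
    simp only [bform, Pi.smul_apply, smul_eq_mul, Finset.mul_sum]
    exact Finset.sum_congr rfl fun i _ => by ring
  rw [hu, hv, hsmul] at h
  exact mul_right_cancel₀ huv (by rw [h, one_mul])

/-- Lemma 2.1: in `F^3` with the form `(e_i, e_j) = δ_{i,4-j}`, if
`g ∈ O_3(F)` stabilizes `F e_1`, `F e_3` and `W_1 = F(e_1 + e_2 - (1/2) e_3)`,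
then `g = ± id`. -/
theorem statement6 (F : Type*) [Field F] (hchar : (2 : F) ≠ 0)
    (g : (Fin 3 → F) ≃ₗ[F] (Fin 3 → F)) (hg : IsOrthMap F 3 g)
    (h1 : Submodule.map g.toLinearMap (Submodule.span F {(![1, 0, 0] : Fin 3 → F)}) =
      Submodule.span F {(![1, 0, 0] : Fin 3 → F)})
    (h3 : Submodule.map g.toLinearMap (Submodule.span F {(![0, 0, 1] : Fin 3 → F)}) =
      Submodule.span F {(![0, 0, 1] : Fin 3 → F)})
    (hW : Submodule.map g.toLinearMap (Submodule.span F {(![1, 1, -(2⁻¹ : F)] : Fin 3 → F)}) =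
      Submodule.span F {(![1, 1, -(2⁻¹ : F)] : Fin 3 → F)}) :
    (∀ v, g v = v) ∨ (∀ v, g v = -v) := by
  obtain ⟨a, ha⟩ := exists_smul_eq_of_map_span_singleton_eq h1
  obtain ⟨b, hb⟩ := exists_smul_eq_of_map_span_singleton_eq h3
  obtain ⟨c, hc⟩ := exists_smul_eq_of_map_span_singleton_eq hW
  rw [LinearEquiv.coe_coe] at ha hb hc
  have hab : a * b = 1 := hg.mul_eq_one ha hb (by simp [bform, Fin.sum_univ_three, Fin.rev])
  have hca : c * a = 1 :=
    hg.mul_eq_one hc ha (by simpa [bform, Fin.sum_univ_three, Fin.rev] using hchar)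
  have hcb : c * b = 1 := hg.mul_eq_one hc hb (by simp [bform, Fin.sum_univ_three, Fin.rev])
  have hac : a = c := by linear_combination c * hab - a * hcb
  have hbc : b = c := by linear_combination c * hab - b * hca
  subst hac hbc
  have hv (v : Fin 3 → F) : g v = b • v := by
    have hdecomp : v = (v 0 - v 1) • ![1, 0, 0] + v 1 • ![1, 1, -(2⁻¹ : F)]
        + (v 2 + v 1 * 2⁻¹) • ![0, 0, 1] := by
      ext i
      fin_cases i <;> simp
    rw [hdecomp, map_add, map_add, map_smul, map_smul, map_smul, ha, hb, hc]
    simp only [smul_add, smul_comm b]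
  rcases mul_self_eq_one_iff.mp hab with rfl | rfl
  · exact Or.inl fun v => by rw [hv, one_smul]
  · exact Or.inr fun v => by rw [hv, neg_one_smul]
end

section
/- Let F be a field with char F ≠ 2. Equip F^5 with the symmetric bilinear form (f_i, f_j) = δ_{i, 6-j} on the standard basis f_1, …, f_5. Let U = span(f_4, f_5) and U' = F·(f_1 + f_3 − (1/2)f_5). If g ∈ O_5(F) satisfies g(F·(f_1 + f_2)) = F·(f_1 + f_2), g(span(f_1, f_2)) = span(f_1, f_2), gU = U and gU' = U', then g = id or g = −id. -/
open Module

/-- The form on `F^5`, written out in coordinates. -/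
theorem bform_five {F : Type*} [Field F] (u v : Fin 5 → F) :
    bform F 5 u v = u 0 * v 4 + u 1 * v 3 + u 2 * v 2 + u 3 * v 1 + u 4 * v 0 := by
  simp [bform, Fin.sum_univ_five, Fin.rev]

/-- A linear map preserving a line acts on its generator by a scalar. -/
theorem exists_smul_of_map_span_singleton {F V : Type*} [Field F] [AddCommGroup V] [Module F V]
    {g : V →ₗ[F] V} {x : V} (h : Submodule.map g (Submodule.span F {x}) = Submodule.span F {x}) :
    ∃ c : F, g x = c • x := by
  have hx : g x ∈ Submodule.span F {x} :=
    h ▸ Submodule.mem_map_of_mem (Submodule.mem_span_singleton_self x)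
  obtain ⟨c, hc⟩ := Submodule.mem_span_singleton.mp hx
  exact ⟨c, hc.symm⟩

/-- If an isometry `g` preserves a subspace `W` and `v` is orthogonal to `W`, so is `g v`. -/
theorem IsOrthMap.orthogonal_of_map_eq {F : Type*} [Field F] {N : ℕ}
    {g : (Fin N → F) ≃ₗ[F] (Fin N → F)} (hg : IsOrthMap F N g) {W : Submodule F (Fin N → F)}
    (hW : Submodule.map g.toLinearMap W = W) {v : Fin N → F} (hv : ∀ w ∈ W, bform F N v w = 0) :
    ∀ w ∈ W, bform F N (g v) w = 0 := by
  intro w hw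
  rw [← hW] at hw
  obtain ⟨w', hw', rfl⟩ := hw
  exact (hg v w').trans (hv w' hw')

/-- Lemma 2.5: in `F^5` with the form `(f_i, f_j) = δ_{i,6-j}`, if
`g ∈ O_5(F)` stabilizes the flag `F(f_1+f_2) ⊂ span(f_1,f_2)`, the subspace
`U = span(f_4,f_5)` and `U' = F(f_1 + f_3 - (1/2) f_5)`, then `g = ± id`. -/
theorem statement7 (F : Type*) [Field F] (hchar : (2 : F) ≠ 0)
    (g : (Fin 5 → F) ≃ₗ[F] (Fin 5 → F)) (hg : IsOrthMap F 5 g)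
    (hflag1 : Submodule.map g.toLinearMap (Submodule.span F {(![1, 1, 0, 0, 0] : Fin 5 → F)}) =
      Submodule.span F {(![1, 1, 0, 0, 0] : Fin 5 → F)})
    (hflag2 : Submodule.map g.toLinearMap
        (Submodule.span F {(![1, 0, 0, 0, 0] : Fin 5 → F), ![0, 1, 0, 0, 0]}) =
      Submodule.span F {(![1, 0, 0, 0, 0] : Fin 5 → F), ![0, 1, 0, 0, 0]})
    (hU : Submodule.map g.toLinearMap
        (Submodule.span F {(![0, 0, 0, 1, 0] : Fin 5 → F), ![0, 0, 0, 0, 1]}) =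
      Submodule.span F {(![0, 0, 0, 1, 0] : Fin 5 → F), ![0, 0, 0, 0, 1]})
    (hU' : Submodule.map g.toLinearMap
        (Submodule.span F {(![1, 0, 1, 0, -(2⁻¹ : F)] : Fin 5 → F)}) =
      Submodule.span F {(![1, 0, 1, 0, -(2⁻¹ : F)] : Fin 5 → F)}) :
    (∀ v, g v = v) ∨ (∀ v, g v = -v) := by
  obtain ⟨a, ha⟩ := exists_smul_of_map_span_singleton hflag1
  obtain ⟨c, hc⟩ := exists_smul_of_map_span_singleton hU'
  simp only [LinearEquiv.coe_coe] at ha hc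
  set e₁ : Fin 5 → F := ![1, 0, 0, 0, 0] with he₁
  set e₂ : Fin 5 → F := ![0, 1, 0, 0, 0] with he₂
  set e₃ : Fin 5 → F := ![0, 0, 1, 0, 0] with he₃
  set e₄ : Fin 5 → F := ![0, 0, 0, 1, 0] with he₄
  set e₅ : Fin 5 → F := ![0, 0, 0, 0, 1] with he₅
  have mem₁ : e₁ ∈ Submodule.span F {e₁, e₂} := Submodule.subset_span (by simp)
  have mem₂ : e₂ ∈ Submodule.span F {e₁, e₂} := Submodule.subset_span (by simp)
  have mem₄ : e₄ ∈ Submodule.span F {e₄, e₅} := Submodule.subset_span (by simp)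
  have mem₅ : e₅ ∈ Submodule.span F {e₄, e₅} := Submodule.subset_span (by simp)
  obtain ⟨p, q, h₁⟩ := Submodule.mem_span_pair.mp
    (hflag2.le (Submodule.mem_map_of_mem (f := g.toLinearMap) mem₁))
  obtain ⟨r, s, h₄⟩ := Submodule.mem_span_pair.mp
    (hU.le (Submodule.mem_map_of_mem (f := g.toLinearMap) mem₄))
  obtain ⟨t, u, h₅⟩ := Submodule.mem_span_pair.mp
    (hU.le (Submodule.mem_map_of_mem (f := g.toLinearMap) mem₅))
  simp only [LinearEquiv.coe_coe] at h₁ h₄ h₅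
  have orthW := hg.orthogonal_of_map_eq hflag2 (v := e₃) (by
    intro w hw
    obtain ⟨x, y, rfl⟩ := Submodule.mem_span_pair.mp hw
    simp [bform_five, he₁, he₂, he₃])
  have orthU := hg.orthogonal_of_map_eq hU (v := e₃) (by
    intro w hw
    obtain ⟨x, y, rfl⟩ := Submodule.mem_span_pair.mp hw
    simp [bform_five, he₃, he₄, he₅])
  have z₄ : g e₃ 4 = 0 := by simpa [bform_five, he₁] using orthW e₁ mem₁
  have z₃ : g e₃ 3 = 0 := by simpa [bform_five, he₂] using orthW e₂ mem₂
  have z₁ : g e₃ 1 = 0 := by simpa [bform_five, he₄] using orthU e₄ mem₄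
  have z₀ : g e₃ 0 = 0 := by simpa [bform_five, he₅] using orthU e₅ mem₅
  obtain ⟨m, hm⟩ : ∃ m : F, g e₃ = m • e₃ :=
    ⟨g e₃ 2, by ext i; fin_cases i <;> simp [he₃] <;> assumption⟩
  have flag_vec : (![1, 1, 0, 0, 0] : Fin 5 → F) = e₁ + e₂ := by
    ext i; fin_cases i <;> simp [he₁, he₂]
  have line_vec : (![1, 0, 1, 0, -(2⁻¹ : F)] : Fin 5 → F) = e₁ + e₃ - (2⁻¹ : F) • e₅ := by
    ext i; fin_cases i <;> simp [he₁, he₃, he₅]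
  rw [flag_vec, map_add] at ha
  rw [line_vec, map_sub, map_add, map_smul, ← h₁, hm, ← h₅] at hc
  have hp : p = c := by
    simpa [he₁, he₂, he₃, he₄, he₅] using congrFun hc 0
  have hq : q = 0 := by
    simpa [he₁, he₂, he₃, he₄, he₅] using congrFun hc 1
  have hmc : m = c := by
    simpa [he₁, he₂, he₃, he₄, he₅] using congrFun hc 2
  have ht : t = 0 := by
    simpa [hchar, he₁, he₂, he₃, he₄, he₅] using congrFun hc 3
  have hu : u = c := by
    have := congrFun hc 4
    simp [he₁, he₂, he₃, he₄, he₅] at this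
    simpa [mul_comm c, hchar] using this
  subst hp hq ht hu
  have g₁ : g e₁ = u • e₁ := by simp [← h₁]
  have g₅ : g e₅ = u • e₅ := by simp [← h₅]
  have g₃ : g e₃ = u • e₃ := by rw [hm, hmc]
  have g₂ : g e₂ = a • (e₁ + e₂) - u • e₁ := by rw [← ha, g₁]; abel
  have huu : u * u = 1 := by
    have h := hg e₃ e₃
    rw [g₃] at h
    simpa [bform_five, he₃] using h
  have hu0 : u ≠ 0 := left_ne_zero_of_mul_eq_one huu
  have hau : a = u := by
    have := hg e₂ e₅
    rw [g₂, g₅] at this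
    simp [bform_five, he₁, he₂, he₅, hu0] at this
    exact sub_eq_zero.mp this
  subst hau
  have g₂' : g e₂ = a • e₂ := by rw [g₂, smul_add]; abel
  have hs : s = 0 := by
    have h := hg e₁ e₄
    rw [g₁, ← h₄] at h
    simpa [bform_five, he₁, he₄, he₅, hu0] using h
  have hr : r = a := by
    have : a * r = 1 := by
      have h := hg e₂ e₄
      rw [g₂', ← h₄] at h
      simpa [bform_five, he₂, he₄, he₅] using h
    exact mul_left_cancel₀ hu0 (this.trans huu.symm)
  have g₄ : g e₄ = a • e₄ := by simp [← h₄, hs, hr]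
  have hscalar : ∀ v, g v = a • v := by
    intro v
    have hv : v = v 0 • e₁ + v 1 • e₂ + v 2 • e₃ + v 3 • e₄ + v 4 • e₅ := by
      ext i; fin_cases i <;> simp [he₁, he₂, he₃, he₄, he₅]
    rw [hv]
    simp only [map_add, map_smul, g₁, g₂', g₃, g₄, g₅, smul_add, smul_comm a]
  rcases mul_self_eq_one_iff.mp huu with h | h
  · exact Or.inl fun v => by rw [hscalar, h, one_smul]
  · exact Or.inr fun v => by rw [hscalar, h, neg_smul, one_smul]
end

section
/- Let F be a field with char F ≠ 2. Equip F^6 with the symmetric bilinear form (f_i, f_j) = δ_{i, 7-j} on the standard basis f_1, …, f_6. Let U_1 = span(f_1, f_2), U_2 = span(f_5, f_6), and for λ ∈ F let U_{3,λ} = span(f_1 + f_3 + f_5, λf_2 − f_4 + (1−λ)f_6). If g ∈ O_6(F) satisfies gU_1 = U_1, gU_2 = U_2 and gU_{3,λ} = U_{3,μ} for some λ, μ ∈ F, then λ = μ or λ = 1 − μ. -/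
open Module

/-- A linear map carrying the span of a pair into the span of another sends each vector of the first
pair to a linear combination of the second. -/
theorem exists_smul_add_smul_of_map_span_pair_eq {F V W : Type*} [Field F] [AddCommGroup V]
    [Module F V] [AddCommGroup W] [Module F W] {g : V →ₗ[F] W} {x y : V} {x' y' : W}
    (h : Submodule.map g (Submodule.span F {x, y}) = Submodule.span F {x', y'}) :
    (∃ a b : F, a • x' + b • y' = g x) ∧ ∃ a b : F, a • x' + b • y' = g y := by
  simp only [← Submodule.mem_span_pair, ← h]
  exact ⟨Submodule.mem_map_of_mem (Submodule.subset_span (by simp)),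
    Submodule.mem_map_of_mem (Submodule.subset_span (by simp))⟩

theorem bform_six {F : Type*} [Field F] (u v : Fin 6 → F) :
    bform F 6 u v =
      u 0 * v 5 + u 1 * v 4 + u 2 * v 3 + u 3 * v 2 + u 4 * v 1 + u 5 * v 0 := by
  simp only [bform, Fin.sum_univ_six]
  rfl

/-- Lemma 2.9: in `F^6` with the form `(f_i, f_j) = δ_{i,7-j}`, let
`U_1 = span(f_1,f_2)`, `U_2 = span(f_5,f_6)` and
`U_{3,λ} = span(f_1+f_3+f_5, λf_2 - f_4 + (1-λ)f_6)`. If `g ∈ O_6(F)` satisfies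
`gU_1 = U_1`, `gU_2 = U_2` and `gU_{3,λ} = U_{3,μ}`, then `λ = μ` or `λ = 1 - μ`. -/
theorem statement9 (F : Type*) [Field F] (hchar : (2 : F) ≠ 0)
    (g : (Fin 6 → F) ≃ₗ[F] (Fin 6 → F)) (hg : IsOrthMap F 6 g) (lam mu : F)
    (hU1 : Submodule.map g.toLinearMap
        (Submodule.span F {(![1, 0, 0, 0, 0, 0] : Fin 6 → F), ![0, 1, 0, 0, 0, 0]}) =
      Submodule.span F {(![1, 0, 0, 0, 0, 0] : Fin 6 → F), ![0, 1, 0, 0, 0, 0]})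
    (hU2 : Submodule.map g.toLinearMap
        (Submodule.span F {(![0, 0, 0, 0, 1, 0] : Fin 6 → F), ![0, 0, 0, 0, 0, 1]}) =
      Submodule.span F {(![0, 0, 0, 0, 1, 0] : Fin 6 → F), ![0, 0, 0, 0, 0, 1]})
    (hU3 : Submodule.map g.toLinearMap
        (Submodule.span F {(![1, 0, 1, 0, 1, 0] : Fin 6 → F), ![0, lam, 0, -1, 0, 1 - lam]}) =
      Submodule.span F {(![1, 0, 1, 0, 1, 0] : Fin 6 → F), ![0, mu, 0, -1, 0, 1 - mu]}) :
    lam = mu ∨ lam = 1 - mu := by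
  obtain ⟨⟨a, b, h1⟩, c, d, h2⟩ := exists_smul_add_smul_of_map_span_pair_eq hU1
  obtain ⟨⟨p, q, h5⟩, r, s, h6⟩ := exists_smul_add_smul_of_map_span_pair_eq hU2
  obtain ⟨⟨α, β, hx⟩, γ, δ, hy⟩ := exists_smul_add_smul_of_map_span_pair_eq hU3
  simp only [LinearEquiv.coe_coe] at h1 h2 h5 h6 hx hy
  -- The remaining two basis vectors, expressed through the generators of the three planes.
  have e3 : (![0, 0, 1, 0, 0, 0] : Fin 6 → F) =
      ![1, 0, 1, 0, 1, 0] - ![1, 0, 0, 0, 0, 0] - ![0, 0, 0, 0, 1, 0] := by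
    ext i; fin_cases i <;> simp
  have e4 : (![0, 0, 0, 1, 0, 0] : Fin 6 → F) =
      lam • ![0, 1, 0, 0, 0, 0] + (1 - lam) • ![0, 0, 0, 0, 0, 1]
        - ![0, lam, 0, -1, 0, 1 - lam] := by
    ext i; fin_cases i <;> simp
  have h3 := congrArg g e3
  have h4 := congrArg g e4
  simp only [map_sub, map_add, map_smul, ← h1, ← h2, ← h5, ← h6, ← hx, ← hy] at h3 h4
  have g16 := hg ![1, 0, 0, 0, 0, 0] ![0, 0, 0, 0, 0, 1]
  have g15 := hg ![1, 0, 0, 0, 0, 0] ![0, 0, 0, 0, 1, 0]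
  have g26 := hg ![0, 1, 0, 0, 0, 0] ![0, 0, 0, 0, 0, 1]
  have g25 := hg ![0, 1, 0, 0, 0, 0] ![0, 0, 0, 0, 1, 0]
  have g13 := hg ![1, 0, 0, 0, 0, 0] ![0, 0, 1, 0, 0, 0]
  have g23 := hg ![0, 1, 0, 0, 0, 0] ![0, 0, 1, 0, 0, 0]
  have g53 := hg ![0, 0, 0, 0, 1, 0] ![0, 0, 1, 0, 0, 0]
  have g63 := hg ![0, 0, 0, 0, 0, 1] ![0, 0, 1, 0, 0, 0]
  have g14 := hg ![1, 0, 0, 0, 0, 0] ![0, 0, 0, 1, 0, 0]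
  have g24 := hg ![0, 1, 0, 0, 0, 0] ![0, 0, 0, 1, 0, 0]
  have g54 := hg ![0, 0, 0, 0, 1, 0] ![0, 0, 0, 1, 0, 0]
  have g64 := hg ![0, 0, 0, 0, 0, 1] ![0, 0, 0, 1, 0, 0]
  have g33 := hg ![0, 0, 1, 0, 0, 0] ![0, 0, 1, 0, 0, 0]
  have g34 := hg ![0, 0, 1, 0, 0, 0] ![0, 0, 0, 1, 0, 0]
  simp only [h3, h4, ← h1, ← h2, ← h5, ← h6]
    at g16 g15 g26 g25 g13 g23 g53 g63 g14 g24 g54 g64 g33 g34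
  simp [bform_six] at g16 g15 g26 g25 g13 g23 g53 g63 g14 g24 g54 g64 g33 g34
  have hdet : (a * d - b * c) * (p * s - q * r) = 1 := by
    linear_combination (c * q + d * p) * g16 + g25 - (c * s + d * r) * g15
  have eq_zero_left {X Y : F} (hX : a * X + b * Y = 0) (hY : c * X + d * Y = 0) :
      X = 0 ∧ Y = 0 :=
    ⟨by linear_combination (p * s - q * r) * (d * hX - b * hY) - X * hdet,
      by linear_combination (p * s - q * r) * (a * hY - c * hX) - Y * hdet⟩
  have eq_zero_right {X Y : F} (hX : p * X + q * Y = 0) (hY : r * X + s * Y = 0) :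
      X = 0 ∧ Y = 0 :=
    ⟨by linear_combination (a * d - b * c) * (s * hX - q * hY) - X * hdet,
      by linear_combination (a * d - b * c) * (p * hY - r * hX) - Y * hdet⟩
  -- `g` preserves the span of the third and fourth basis vectors.
  obtain ⟨k1, k2⟩ := eq_zero_left g13 g23
  obtain ⟨k3, k4⟩ := eq_zero_right g53 g63
  obtain ⟨k5, k6⟩ := eq_zero_left g14 g24
  obtain ⟨k7, k8⟩ := eq_zero_right g54 g64
  rw [k1, k2, k3, k4] at g33
  rw [k1, k2, k3, k4] at g34
  have hαβ : α * β = 0 := (mul_eq_zero.mp (by linear_combination -g33 :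
    (2 : F) * (α * β) = 0)).resolve_left hchar
  have hsq : (α * δ - β * γ) ^ 2 = 1 := by
    linear_combination (α * δ + β * γ + 1) * g34 - 4 * γ * δ * hαβ
  have hl : lam * (a * d - b * c) = mu * (α * δ - β * γ) := by
    linear_combination a * k7 - b * k8 - δ * mu * k4 + γ * k3
  have hr : (1 - lam) * (p * s - q * r) = (1 - mu) * (α * δ - β * γ) := by
    linear_combination p * k5 - q * k6 - δ * (1 - mu) * k2 + γ * k1
  have hmul : (lam - mu) * (lam - (1 - mu)) = 0 := by
    linear_combination lam * (1 - lam) * hdet - mu * (1 - mu) * hsq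
      - (1 - lam) * (p * s - q * r) * hl - mu * (α * δ - β * γ) * hr
  exact (mul_eq_zero.mp hmul).imp sub_eq_zero.mp sub_eq_zero.mp
end

section
/- Let F be a field with char F ≠ 2. Equip F^6 with the symmetric bilinear form (f_i, f_j) = δ_{i, 7-j} on the standard basis f_1, …, f_6. Let U_1 = span(f_1, f_2), U_2 = span(f_5, f_6), U_5 = span(f_1 − f_5, f_1 − f_3, f_2 + f_4 + f_6), and for λ ∈ F let U_{4,λ} = F·(λf_1 − f_3 + (1−λ)f_5). If g ∈ O_6(F) satisfies gU_1 = U_1, gU_2 = U_2, gU_{4,λ} = U_{4,μ} and gU_5 = U_5 for some λ, μ ∈ F, then λ = μ. -/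
open Module

/-- Lemma 2.12: in `F^6` with the form `(f_i, f_j) = δ_{i,7-j}`, let
`U_1 = span(f_1,f_2)`, `U_2 = span(f_5,f_6)`,
`U_5 = span(f_1-f_5, f_1-f_3, f_2+f_4+f_6)` and `U_{4,λ} = F(λf_1 - f_3 + (1-λ)f_5)`.
If `g ∈ O_6(F)` satisfies `gU_1 = U_1`, `gU_2 = U_2`, `gU_{4,λ} = U_{4,μ}` and
`gU_5 = U_5`, then `λ = μ`. -/
theorem statement10 (F : Type*) [Field F] (hchar : (2 : F) ≠ 0)
    (g : (Fin 6 → F) ≃ₗ[F] (Fin 6 → F)) (hg : IsOrthMap F 6 g) (lam mu : F)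
    (hU1 : Submodule.map g.toLinearMap
        (Submodule.span F {(![1, 0, 0, 0, 0, 0] : Fin 6 → F), ![0, 1, 0, 0, 0, 0]}) =
      Submodule.span F {(![1, 0, 0, 0, 0, 0] : Fin 6 → F), ![0, 1, 0, 0, 0, 0]})
    (hU2 : Submodule.map g.toLinearMap
        (Submodule.span F {(![0, 0, 0, 0, 1, 0] : Fin 6 → F), ![0, 0, 0, 0, 0, 1]}) =
      Submodule.span F {(![0, 0, 0, 0, 1, 0] : Fin 6 → F), ![0, 0, 0, 0, 0, 1]})
    (hU4 : Submodule.map g.toLinearMap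
        (Submodule.span F {(![lam, 0, -1, 0, 1 - lam, 0] : Fin 6 → F)}) =
      Submodule.span F {(![mu, 0, -1, 0, 1 - mu, 0] : Fin 6 → F)})
    (hU5 : Submodule.map g.toLinearMap
        (Submodule.span F {(![1, 0, 0, 0, -1, 0] : Fin 6 → F), ![1, 0, -1, 0, 0, 0],
          ![0, 1, 0, 1, 0, 1]}) =
      Submodule.span F {(![1, 0, 0, 0, -1, 0] : Fin 6 → F), ![1, 0, -1, 0, 0, 0],
          ![0, 1, 0, 1, 0, 1]}) :
    lam = mu := by
  obtain ⟨a, b, h1⟩ := Submodule.mem_span_pair.1 <|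
    hU1.le (Submodule.mem_map_of_mem (Submodule.subset_span (Set.mem_insert _ _)))
  obtain ⟨a', b', h2⟩ := Submodule.mem_span_pair.1 <|
    hU1.le (Submodule.mem_map_of_mem (Submodule.subset_span (Set.mem_insert_of_mem _ rfl)))
  obtain ⟨d, e, h5⟩ := Submodule.mem_span_pair.1 <|
    hU2.le (Submodule.mem_map_of_mem (Submodule.subset_span (Set.mem_insert _ _)))
  obtain ⟨d', e', h6⟩ := Submodule.mem_span_pair.1 <|
    hU2.le (Submodule.mem_map_of_mem (Submodule.subset_span (Set.mem_insert_of_mem _ rfl)))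
  obtain ⟨c, h4⟩ := Submodule.mem_span_singleton.1 <|
    hU4.le (Submodule.mem_map_of_mem (Submodule.mem_span_singleton_self _))
  obtain ⟨x, y, z, hx⟩ := Submodule.mem_span_triple.1 <|
    hU5.le (Submodule.mem_map_of_mem (Submodule.subset_span (Set.mem_insert _ _)))
  simp only [LinearEquiv.coe_coe] at h1 h2 h5 h6 h4 hx
  -- `g (f₁ - f₅) = g f₁ - g f₅` lies in `U₅` and has no `f₃`, `f₄` components.
  have key : g ![1, 0, 0, 0, -1, 0] = g ![1, 0, 0, 0, 0, 0] - g ![0, 0, 0, 0, 1, 0] := by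
    rw [← map_sub]; congr 1; simp
  rw [key, ← h1, ← h5] at hx
  have k0 := congrFun hx 0
  have k1 := congrFun hx 1
  have k2 := congrFun hx 2
  have k3 := congrFun hx 3
  have k4 := congrFun hx 4
  have k5 := congrFun hx 5
  simp at k0 k1 k2 k3 k4 k5
  -- The generator of `U_{4,λ}` pairs with `f₆` and `f₂` to `λ` and `1 - λ`.
  have e16 := hg ![1, 0, 0, 0, 0, 0] ![0, 0, 0, 0, 0, 1]
  have e25 := hg ![0, 0, 0, 0, 1, 0] ![0, 1, 0, 0, 0, 0]
  have e46 := hg ![lam, 0, -1, 0, 1 - lam, 0] ![0, 0, 0, 0, 0, 1]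
  have e42 := hg ![lam, 0, -1, 0, 1 - lam, 0] ![0, 1, 0, 0, 0, 0]
  rw [← h1, ← h6] at e16
  rw [← h5, ← h2] at e25
  rw [← h4, ← h6] at e46
  rw [← h4, ← h2] at e42
  simp [bform, Fin.sum_univ_six, Fin.rev] at e16 e25 e46 e42
  obtain rfl : b = 0 := by rw [← k1, k3]
  obtain rfl : e = 0 := by linear_combination k5 - k3
  obtain rfl : a = d := by linear_combination k4 - k0 + k2
  have hbe : b' = e' := by linear_combination e' * e25 - b' * e16
  have hc : c * e' = 1 := by
    rw [hbe] at e42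
    linear_combination e46 + e42
  linear_combination mu * hc - e46
end

section
/- Let F be a field with char F ≠ 2. Equip F^7 with the symmetric bilinear form (f_i, f_j) = δ_{i, 8-j} on the standard basis f_1, …, f_7. Let U_+ = span(f_1, f_2), U_− = span(f_6, f_7), and U = span(f_2 + f_3, f_1 + f_4 − (1/2)f_7, f_5 − f_6). If g ∈ O_7(F) satisfies g(F·(f_1 + f_2)) = F·(f_1 + f_2), gU_+ = U_+, gU_− = U_− and gU = U, then g = id or g = −id. -/
open Module

theorem bform_map_eq_zero {F : Type*} [Field F] {N : ℕ} {g : (Fin N → F) ≃ₗ[F] (Fin N → F)}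
    (hg : IsOrthMap F N g) {S : Submodule F (Fin N → F)} (hS : S.map g.toLinearMap = S)
    {w : Fin N → F} (hw : ∀ s ∈ S, bform F N w s = 0) {s : Fin N → F} (hs : s ∈ S) :
    bform F N (g w) s = 0 := by
  rw [← hS] at hs
  obtain ⟨t, ht, rfl⟩ := hs
  exact (hg w t).trans (hw t ht)

theorem map_mem_of_map_eq {F V : Type*} [Field F] [AddCommGroup V] [Module F V]
    {g : V ≃ₗ[F] V} {S : Submodule F V} (hS : S.map g.toLinearMap = S) {v : V} (hv : v ∈ S) :
    g v ∈ S :=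
  hS ▸ Submodule.mem_map_of_mem hv

theorem apply_eq_zero_of_orthogonal {F : Type*} [Field F]
    {g : (Fin 7 → F) ≃ₗ[F] (Fin 7 → F)} (hg : IsOrthMap F 7 g)
    (hUp : Submodule.map g.toLinearMap
        (Submodule.span F {(![1, 0, 0, 0, 0, 0, 0] : Fin 7 → F), ![0, 1, 0, 0, 0, 0, 0]}) =
      Submodule.span F {(![1, 0, 0, 0, 0, 0, 0] : Fin 7 → F), ![0, 1, 0, 0, 0, 0, 0]})
    (hUm : Submodule.map g.toLinearMap
        (Submodule.span F {(![0, 0, 0, 0, 0, 1, 0] : Fin 7 → F), ![0, 0, 0, 0, 0, 0, 1]}) =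
      Submodule.span F {(![0, 0, 0, 0, 0, 1, 0] : Fin 7 → F), ![0, 0, 0, 0, 0, 0, 1]})
    (x y z : F) :
    g ![0, 0, x, y, z, 0, 0] 0 = 0 ∧ g ![0, 0, x, y, z, 0, 0] 1 = 0 ∧
      g ![0, 0, x, y, z, 0, 0] 5 = 0 ∧ g ![0, 0, x, y, z, 0, 0] 6 = 0 := by
  have hp : ∀ s ∈ Submodule.span F
      {(![1, 0, 0, 0, 0, 0, 0] : Fin 7 → F), ![0, 1, 0, 0, 0, 0, 0]},
      bform F 7 ![0, 0, x, y, z, 0, 0] s = 0 := by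
    intro s hs
    obtain ⟨a, b, rfl⟩ := Submodule.mem_span_pair.1 hs
    simp [bform, Fin.sum_univ_seven, Fin.rev]
  have hm : ∀ s ∈ Submodule.span F
      {(![0, 0, 0, 0, 0, 1, 0] : Fin 7 → F), ![0, 0, 0, 0, 0, 0, 1]},
      bform F 7 ![0, 0, x, y, z, 0, 0] s = 0 := by
    intro s hs
    obtain ⟨a, b, rfl⟩ := Submodule.mem_span_pair.1 hs
    simp [bform, Fin.sum_univ_seven, Fin.rev]
  have h0 := bform_map_eq_zero hg hUm hm (Submodule.subset_span (Set.mem_insert_of_mem _ rfl))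
  have h1 := bform_map_eq_zero hg hUm hm (Submodule.subset_span (Set.mem_insert _ _))
  have h5 := bform_map_eq_zero hg hUp hp (Submodule.subset_span (Set.mem_insert_of_mem _ rfl))
  have h6 := bform_map_eq_zero hg hUp hp (Submodule.subset_span (Set.mem_insert _ _))
  simp [bform, Fin.sum_univ_seven, Fin.rev] at h0 h1 h5 h6
  exact ⟨h0, h1, h5, h6⟩

/-- Lemma 2.16: in `F^7` with the form `(f_i, f_j) = δ_{i,8-j}`, let
`U_+ = span(f_1,f_2)`, `U_- = span(f_6,f_7)` and
`U = span(f_2+f_3, f_1+f_4-(1/2)f_7, f_5-f_6)`. If `g ∈ O_7(F)` stabilizes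
`F(f_1+f_2)`, `U_+`, `U_-` and `U`, then `g = ± id`. -/
theorem statement11 (F : Type*) [Field F] (hchar : (2 : F) ≠ 0)
    (g : (Fin 7 → F) ≃ₗ[F] (Fin 7 → F)) (hg : IsOrthMap F 7 g)
    (hline : Submodule.map g.toLinearMap
        (Submodule.span F {(![1, 1, 0, 0, 0, 0, 0] : Fin 7 → F)}) =
      Submodule.span F {(![1, 1, 0, 0, 0, 0, 0] : Fin 7 → F)})
    (hUp : Submodule.map g.toLinearMap
        (Submodule.span F {(![1, 0, 0, 0, 0, 0, 0] : Fin 7 → F), ![0, 1, 0, 0, 0, 0, 0]}) =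
      Submodule.span F {(![1, 0, 0, 0, 0, 0, 0] : Fin 7 → F), ![0, 1, 0, 0, 0, 0, 0]})
    (hUm : Submodule.map g.toLinearMap
        (Submodule.span F {(![0, 0, 0, 0, 0, 1, 0] : Fin 7 → F), ![0, 0, 0, 0, 0, 0, 1]}) =
      Submodule.span F {(![0, 0, 0, 0, 0, 1, 0] : Fin 7 → F), ![0, 0, 0, 0, 0, 0, 1]})
    (hU : Submodule.map g.toLinearMap
        (Submodule.span F {(![0, 1, 1, 0, 0, 0, 0] : Fin 7 → F),
          ![1, 0, 0, 1, 0, 0, -(2⁻¹ : F)], ![0, 0, 0, 0, 1, -1, 0]}) =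
      Submodule.span F {(![0, 1, 1, 0, 0, 0, 0] : Fin 7 → F),
          ![1, 0, 0, 1, 0, 0, -(2⁻¹ : F)], ![0, 0, 0, 0, 1, -1, 0]}) :
    (∀ v, g v = v) ∨ (∀ v, g v = -v) := by
  have mem_line := map_mem_of_map_eq hline (Submodule.subset_span rfl)
  have mem_f₁ := map_mem_of_map_eq hUp (Submodule.subset_span (Set.mem_insert _ _))
  have mem_f₂ := map_mem_of_map_eq hUp (Submodule.subset_span (Set.mem_insert_of_mem _ rfl))
  have mem_f₆ := map_mem_of_map_eq hUm (Submodule.subset_span (Set.mem_insert _ _))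
  have mem_f₇ := map_mem_of_map_eq hUm (Submodule.subset_span (Set.mem_insert_of_mem _ rfl))
  have mem_u₁ := map_mem_of_map_eq hU (Submodule.subset_span (Set.mem_insert _ _))
  have mem_u₂ := map_mem_of_map_eq hU
    (Submodule.subset_span (Set.mem_insert_of_mem _ (Set.mem_insert _ _)))
  have mem_u₃ := map_mem_of_map_eq hU
    (Submodule.subset_span (Set.mem_insert_of_mem _ (Set.mem_insert_of_mem _ rfl)))
  obtain ⟨e, he⟩ := Submodule.mem_span_singleton.1 mem_line
  obtain ⟨a, b, h₁⟩ := Submodule.mem_span_pair.1 mem_f₁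
  obtain ⟨c, d, h₂⟩ := Submodule.mem_span_pair.1 mem_f₂
  obtain ⟨p, q, h₆⟩ := Submodule.mem_span_pair.1 mem_f₆
  obtain ⟨r, s, h₇⟩ := Submodule.mem_span_pair.1 mem_f₇
  obtain ⟨α₁, β₁, γ₁, k₁⟩ := Submodule.mem_span_triple.1 mem_u₁
  obtain ⟨α₂, β₂, γ₂, k₂⟩ := Submodule.mem_span_triple.1 mem_u₂
  obtain ⟨α₃, β₃, γ₃, k₃⟩ := Submodule.mem_span_triple.1 mem_u₃
  have h₁₂ : g ![1, 1, 0, 0, 0, 0, 0] =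
      g ![1, 0, 0, 0, 0, 0, 0] + g ![0, 1, 0, 0, 0, 0, 0] := by
    rw [← map_add]; simp
  have h₃ : g ![0, 0, 1, 0, 0, 0, 0] =
      g ![0, 1, 1, 0, 0, 0, 0] - g ![0, 1, 0, 0, 0, 0, 0] := by
    rw [← map_sub]; simp
  have h₄ : g ![0, 0, 0, 1, 0, 0, 0] = g ![1, 0, 0, 1, 0, 0, -(2⁻¹ : F)] -
      g ![1, 0, 0, 0, 0, 0, 0] + (2⁻¹ : F) • g ![0, 0, 0, 0, 0, 0, 1] := by
    rw [← map_smul, ← map_sub, ← map_add]; simp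
  have h₅ : g ![0, 0, 0, 0, 1, 0, 0] =
      g ![0, 0, 0, 0, 1, -1, 0] + g ![0, 0, 0, 0, 0, 1, 0] := by
    rw [← map_add]; simp
  have z₃ := apply_eq_zero_of_orthogonal hg hUp hUm 1 0 0
  have z₄ := apply_eq_zero_of_orthogonal hg hUp hUm 0 1 0
  have z₅ := apply_eq_zero_of_orthogonal hg hUp hUm 0 0 1
  rw [← he, ← h₁, ← h₂] at h₁₂
  have o₁₆ := hg ![1, 0, 0, 0, 0, 0, 0] ![0, 0, 0, 0, 0, 1, 0]
  have o₁₇ := hg ![1, 0, 0, 0, 0, 0, 0] ![0, 0, 0, 0, 0, 0, 1]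
  have o₂₆ := hg ![0, 1, 0, 0, 0, 0, 0] ![0, 0, 0, 0, 0, 1, 0]
  have o₂₇ := hg ![0, 1, 0, 0, 0, 0, 0] ![0, 0, 0, 0, 0, 0, 1]
  rw [← h₁, ← h₆] at o₁₆
  rw [← h₁, ← h₇] at o₁₇
  rw [← h₂, ← h₆] at o₂₆
  rw [← h₂, ← h₇] at o₂₇
  rw [← k₁, ← h₂] at h₃
  rw [← k₂, ← h₁, ← h₇] at h₄
  rw [← k₃, ← h₆] at h₅
  rw [h₃] at z₃
  rw [h₄] at z₄
  rw [h₅] at z₅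
  simp [bform, Fin.sum_univ_seven, Fin.rev] at z₃ z₄ z₅ o₁₆ o₁₇ o₂₆ o₂₇ h₁₂
  obtain ⟨z₃₀, z₃₁, rfl, z₃₆⟩ := z₃
  obtain ⟨z₄₀, z₄₁, z₄₅, z₄₆⟩ := z₄
  obtain ⟨rfl, rfl, z₅₅, z₅₆⟩ := z₅
  obtain ⟨rfl, hbd⟩ := h₁₂
  obtain rfl : β₁ = 0 := z₃₆.resolve_right hchar
  obtain rfl : c = 0 := by linear_combination -z₃₀
  obtain rfl : q = 0 := by linear_combination z₅₆
  have hd : d ≠ 0 := by rintro rfl; simp at o₂₆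
  have hp : p ≠ 0 := by rintro rfl; simp at o₂₆
  obtain rfl : r = 0 := (mul_eq_zero.1 (by linear_combination o₂₇ : d * r = 0)).resolve_left hd
  obtain rfl : b = 0 := (mul_eq_zero.1 (by linear_combination o₁₆ : b * p = 0)).resolve_right hp
  obtain rfl : d = a := by linear_combination -hbd
  obtain rfl : β₂ = d := by linear_combination z₄₀
  obtain rfl : s = β₂ := by
    linear_combination 2 * z₄₆ + (β₂ - s) * mul_inv_cancel₀ hchar
  obtain rfl : p = s := mul_left_cancel₀ hd (by linear_combination o₂₆ - o₁₇)
  obtain rfl : α₁ = p := by linear_combination z₃₁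
  obtain rfl : α₂ = 0 := by linear_combination z₄₁
  obtain rfl : γ₂ = 0 := by linear_combination -z₄₅
  obtain rfl : γ₃ = α₁ := by linear_combination -z₅₅
  have g_smul : ∀ v, g v = γ₃ • v := by
    intro v
    have hv : v = v 0 • ![1, 0, 0, 0, 0, 0, 0] + v 1 • ![0, 1, 0, 0, 0, 0, 0] +
        v 2 • ![0, 0, 1, 0, 0, 0, 0] + v 3 • ![0, 0, 0, 1, 0, 0, 0] +
        v 4 • ![0, 0, 0, 0, 1, 0, 0] + v 5 • ![0, 0, 0, 0, 0, 1, 0] +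
        v 6 • ![0, 0, 0, 0, 0, 0, 1] := by
      ext i; fin_cases i <;> simp
    conv_lhs => rw [hv]
    simp only [map_add, map_smul, h₃, h₄, h₅, ← h₁, ← h₂, ← h₆, ← h₇]
    ext i; fin_cases i <;> simp <;> ring
  have hsq : γ₃ * γ₃ = 1 := by linear_combination o₁₇
  rcases mul_self_eq_one_iff.1 hsq with rfl | rfl
  · exact Or.inl fun v => by rw [g_smul, one_smul]
  · exact Or.inr fun v => by rw [g_smul, neg_one_smul]
end
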